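/- arXiv:2210.11008 — 3 statements merged into one kernel-verified Lean document; each statement's English description precedes it below -/
import Mathlib

section
/- Let Ω be a locally compact Hausdorff space with countable base and let G be a quasi-metric kernel on Ω with quasi-metric constant κ ≥ 1/2. Then G satisfies the weak maximum principle with constant 𝔟 = 2κ: for every locally finite Radon measure μ on Ω, if Gμ(x) ≤ 1 for all x in the closed support of μ, then Gμ(x) ≤ 2κ for all x ∈ Ω. -/
open MeasureTheory ENNReal Set

noncomputable section

namespace NPE

variable {Ω : Type*} [TopologicalSpace Ω] [MeasurableSpace Ω]

/-- The potential `Gμ(x) = ∫_Ω G(x,y) dμ(y)`. -/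
def pot (G : Ω → Ω → ℝ≥0∞) (μ : Measure Ω) (x : Ω) : ℝ≥0∞ :=
  ∫⁻ y, G x y ∂μ

/-- The potential `G(f dσ)(x) = ∫_Ω G(x,y) f(y) dσ(y)`. -/
def potF (G : Ω → Ω → ℝ≥0∞) (σ : Measure Ω) (f : Ω → ℝ≥0∞) (x : Ω) : ℝ≥0∞ :=
  ∫⁻ y, G x y * f y ∂σ

/-- A kernel on `Ω` is a lower semicontinuous function `Ω × Ω → [0,∞]`. -/
def IsKernel (G : Ω → Ω → ℝ≥0∞) : Prop :=
  LowerSemicontinuous (fun p : Ω × Ω => G p.1 p.2)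

/-- A quasi-metric kernel with quasi-metric constant `κ ≥ 1/2`: positive, symmetric and
`d := 1/G` satisfies the quasi-triangle inequality. -/
def IsQuasiMetricKernel (G : Ω → Ω → ℝ≥0∞) (κ : ℝ) : Prop :=
  IsKernel G ∧ (1 / 2 : ℝ) ≤ κ ∧ (∀ x y, 0 < G x y) ∧ (∀ x y, G x y = G y x) ∧
    ∀ x y z, (G x y)⁻¹ ≤ ENNReal.ofReal κ * ((G x z)⁻¹ + (G z y)⁻¹)

/-- The closed support of a measure. -/
def msupp (μ : Measure Ω) : Set Ω :=
  {x | ∀ U : Set Ω, IsOpen U → x ∈ U → 0 < μ U}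

/-- The weak maximum principle with constant `b ≥ 1`. -/
def WMP (G : Ω → Ω → ℝ≥0∞) (b : ℝ) : Prop :=
  1 ≤ b ∧ ∀ μ : Measure Ω, IsLocallyFiniteMeasure μ →
    (∀ x ∈ msupp μ, pot G μ x ≤ 1) → ∀ x, pot G μ x ≤ ENNReal.ofReal b

/-- Quasi-symmetry with constant `a ≥ 1`. -/
def QS (G : Ω → Ω → ℝ≥0∞) (a : ℝ) : Prop :=
  1 ≤ a ∧ ∀ x y, (ENNReal.ofReal a)⁻¹ * G y x ≤ G x y ∧ G x y ≤ ENNReal.ofReal a * G y x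

/-- The `L^q` quasi-norm of a nonnegative function with respect to `σ`. -/
def lqNorm (q : ℝ) (σ : Measure Ω) (f : Ω → ℝ≥0∞) : ℝ≥0∞ :=
  (∫⁻ x, f x ^ q ∂σ) ^ (1 / q)

/-- The least constant `ϰ` in the `(1,q)` weighted norm inequality
`‖Gν‖_{L^q(σ)} ≤ C ‖ν‖` over all finite Radon measures `ν`. -/
def kappa (G : Ω → Ω → ℝ≥0∞) (q : ℝ) (σ : Measure Ω) : ℝ≥0∞ :=
  sInf {C : ℝ≥0∞ | ∀ ν : Measure Ω, IsFiniteMeasure ν →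
    lqNorm q σ (pot G ν) ≤ C * ν Set.univ}

/-- The ball `B(x,r) = {y : G(x,y) > 1/r}`, i.e. `{y : d(x,y) < r}` with `d = 1/G`. -/
def ball (G : Ω → Ω → ℝ≥0∞) (x : Ω) (r : ℝ) : Set Ω :=
  {y | (G x y)⁻¹ < ENNReal.ofReal r}

/-- The intrinsic nonlinear potential
`Kσ(x) = ∫_0^∞ ϰ(B(x,r))^{q/(1-q)} r⁻² dr`. -/
def kpot (G : Ω → Ω → ℝ≥0∞) (q : ℝ) (σ : Measure Ω) (x : Ω) : ℝ≥0∞ :=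
  ∫⁻ r in Set.Ioi (0 : ℝ),
    kappa G q (σ.restrict (ball G x r)) ^ (q / (1 - q)) / ENNReal.ofReal (r ^ 2)

/-- A nontrivial super-solution of `u = G(u^q dσ) + d`:
`u > 0` σ-a.e. and `G(u^q dσ) + d ≤ u < ∞` σ-a.e. -/
def IsSupSol (G : Ω → Ω → ℝ≥0∞) (σ : Measure Ω) (q : ℝ) (d : Ω → ℝ≥0∞)
    (u : Ω → ℝ≥0∞) : Prop :=
  Measurable u ∧ (∀ᵐ x ∂σ, 0 < u x) ∧
    ∀ᵐ x ∂σ, potF G σ (fun y => u y ^ q) x + d x ≤ u x ∧ u x < ∞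

/-- A sub-solution: `u ≤ G(u^q dσ) + d < ∞` σ-a.e. -/
def IsSubSol (G : Ω → Ω → ℝ≥0∞) (σ : Measure Ω) (q : ℝ) (d : Ω → ℝ≥0∞)
    (u : Ω → ℝ≥0∞) : Prop :=
  Measurable u ∧
    ∀ᵐ x ∂σ, u x ≤ potF G σ (fun y => u y ^ q) x + d x ∧
      potF G σ (fun y => u y ^ q) x + d x < ∞

/-- A nontrivial solution: `u > 0` σ-a.e. and `u = G(u^q dσ) + d`, `u < ∞`, σ-a.e. -/
def IsSol (G : Ω → Ω → ℝ≥0∞) (σ : Measure Ω) (q : ℝ) (d : Ω → ℝ≥0∞)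
    (u : Ω → ℝ≥0∞) : Prop :=
  Measurable u ∧ (∀ᵐ x ∂σ, 0 < u x) ∧
    ∀ᵐ x ∂σ, u x = potF G σ (fun y => u y ^ q) x + d x ∧ u x < ∞

/-- The growth conditions `∫_a^∞ σ(B(x₀,r)) r⁻² dr < ∞`,
`∫_a^∞ ϰ(B(x₀,r))^{q/(1-q)} r⁻² dr < ∞` and `∫_a^∞ μ(B(x₀,r)) r⁻² dr < ∞`. -/
def growthConds (G : Ω → Ω → ℝ≥0∞) (q : ℝ) (σ μ : Measure Ω) (x₀ : Ω) (a : ℝ) : Prop :=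
  (∫⁻ r in Set.Ioi a, σ (ball G x₀ r) / ENNReal.ofReal (r ^ 2)) < ∞ ∧
  (∫⁻ r in Set.Ioi a,
      kappa G q (σ.restrict (ball G x₀ r)) ^ (q / (1 - q)) / ENNReal.ofReal (r ^ 2)) < ∞ ∧
  (∫⁻ r in Set.Ioi a, μ (ball G x₀ r) / ENNReal.ofReal (r ^ 2)) < ∞

/-- The modified kernel `G̃(x,y) = G(x,y)/(m(x)m(y))`. -/
def modKer (G : Ω → Ω → ℝ≥0∞) (m : Ω → ℝ) : Ω → Ω → ℝ≥0∞ :=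
  fun x y => G x y / (ENNReal.ofReal (m x) * ENNReal.ofReal (m y))

/-- The modified measure `dσ̃ = m^{1+q} dσ`. -/
def modMeas (σ : Measure Ω) (m : Ω → ℝ) (q : ℝ) : Measure Ω :=
  σ.withDensity fun x => ENNReal.ofReal (m x) ^ ((1 : ℝ) + q)

/-- A quasi-metric kernel with quasi-metric constant `κ` satisfies the weak
maximum principle with constant `𝔟 = 2κ`. -/
theorem statement0 [LocallyCompactSpace Ω] [T2Space Ω] [SecondCountableTopology Ω]
    [BorelSpace Ω] (G : Ω → Ω → ℝ≥0∞) (κ : ℝ) (hG : IsQuasiMetricKernel G κ) :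
    WMP G (2 * κ) := by
  obtain ⟨hK, hκ, hpos, hsymm, htri⟩ := hG
  refine ⟨by linarith, ?_⟩
  intro μ _ hμ x
  have hmeas : Measurable (fun y => G x y) := by
    have h1 : LowerSemicontinuous (fun y => G x y) :=
      LowerSemicontinuous.comp (f := fun p : Ω × Ω => G p.1 p.2) (g := fun y : Ω => (x, y))
        hK (by fun_prop)
    exact h1.measurable
  have hnull : μ (msupp μ)ᶜ = 0 := by
    refine measure_null_of_locally_null _ ?_
    intro y hy
    simp only [msupp, mem_compl_iff, mem_ofPred_eq, not_forall] at hy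
    obtain ⟨U, hU, hyU, h0⟩ := hy
    exact ⟨U, mem_nhdsWithin_of_mem_nhds (hU.mem_nhds hyU), by simpa using h0⟩
  have hae : ∀ᵐ y ∂μ, y ∈ msupp μ := hnull
  rcases (msupp μ).eq_empty_or_nonempty with hS | hS
  · have h0 : μ = 0 := by
      rw [hS, compl_empty] at hnull
      exact Measure.measure_univ_eq_zero.mp hnull
    simp [pot, h0]
  set D : Set ℝ≥0∞ := (fun y => (G x y)⁻¹) '' msupp μ with hD
  obtain ⟨u, -, hu, hmem⟩ := exists_seq_tendsto_sInf (hS.image (fun y => (G x y)⁻¹))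
    (OrderBot.bddBelow _)
  choose z hz hzu using hmem
  set k := ENNReal.ofReal κ with hk
  have hk0 : k ≠ 0 := by
    rw [hk, Ne, ENNReal.ofReal_eq_zero]; linarith
  have hkt : k ≠ ∞ := ENNReal.ofReal_ne_top
  have h2k : ENNReal.ofReal (2 * κ) = 2 * k := by
    rw [ENNReal.ofReal_mul (by norm_num)]; simp [hk]
  rw [h2k]
  have h2k0 : 2 * k ≠ 0 := mul_ne_zero two_ne_zero hk0
  have h2kt : 2 * k ≠ ∞ := ENNReal.mul_ne_top (by simp) hkt
  let f : ℕ → Ω → ℝ≥0∞ := fun n y => (k * (u n + (G x y)⁻¹))⁻¹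
  have hfm : ∀ n, Measurable (f n) := fun n =>
    ((hmeas.inv.const_add (u n)).const_mul k).inv
  have hf1 : ∀ n, ∫⁻ y, f n y ∂μ ≤ 1 := by
    intro n
    refine le_trans (lintegral_mono fun y => ?_) (hμ (z n) (hz n))
    have := htri (z n) y x
    rw [hsymm (z n) x] at this
    simp only [f]
    rw [← hzu n, ENNReal.inv_le_iff_inv_le]
    exact this
  have hF : ∫⁻ y, Filter.liminf (fun n => f n y) Filter.atTop ∂μ ≤ 1 := by
    refine (lintegral_liminf_le hfm).trans ?_
    refine Filter.liminf_le_of_le (by isBoundedDefault) ?_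
    intro b hb
    obtain ⟨n, hn⟩ := hb.exists
    exact hn.trans (hf1 n)
  have hlow : ∀ᵐ y ∂μ, (2 * k)⁻¹ * G x y ≤ Filter.liminf (fun n => f n y) Filter.atTop := by
    filter_upwards [hae] with y hy
    have ht : Filter.Tendsto (fun n => f n y) Filter.atTop
        (nhds (k * (sInf D + (G x y)⁻¹))⁻¹) :=
      (ENNReal.Tendsto.const_mul (hu.add tendsto_const_nhds) (Or.inr hkt)).inv
    rw [ht.liminf_eq]
    have hle : sInf D ≤ (G x y)⁻¹ := sInf_le ⟨y, hy, rfl⟩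
    calc (2 * k)⁻¹ * G x y = (2 * k * (G x y)⁻¹)⁻¹ := by
          rw [ENNReal.mul_inv (Or.inl h2k0) (Or.inl h2kt), inv_inv]
      _ ≤ _ := by
          rw [ENNReal.inv_le_inv]
          calc k * (sInf D + (G x y)⁻¹) ≤ k * ((G x y)⁻¹ + (G x y)⁻¹) := by gcongr
            _ = 2 * k * (G x y)⁻¹ := by ring
  have hfin := (lintegral_mono_ae hlow).trans hF
  rw [lintegral_const_mul _ hmeas] at hfin
  calc pot G μ x = 2 * k * ((2 * k)⁻¹ * ∫⁻ y, G x y ∂μ) := by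
        rw [← mul_assoc, ENNReal.mul_inv_cancel h2k0 h2kt, one_mul, pot]
    _ ≤ 2 * k * 1 := by gcongr
    _ = 2 * k := mul_one _

end NPE
end
end

section
/- Let Ω be a locally compact Hausdorff space with countable base, 0 < q < 1, μ and σ locally finite Radon measures on Ω with σ ≠ 0, and G a quasi-metric kernel on Ω. If u₁ and u₂ are both nontrivial solutions of u = G(u^q dσ) + Gμ with 0 < u < +∞ σ-a.e. in Ω, then u₁ = u₂ σ-a.e. in Ω. -/
open MeasureTheory ENNReal Set

noncomputable section

namespace NPE

variable {Ω : Type*} [TopologicalSpace Ω] [MeasurableSpace Ω]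

lemma aux_layer_pt (a : ℝ≥0∞) : ∫⁻ τ in Ioi (0:ℝ), (if ENNReal.ofReal τ < a then (1:ℝ≥0∞) else 0) = a := by
  have h1 : (fun τ : ℝ => (if ENNReal.ofReal τ < a then (1:ℝ≥0∞) else 0))
      = indicator {τ : ℝ | ENNReal.ofReal τ < a} 1 := by
    ext τ; simp [indicator]
  have hm : MeasurableSet {τ : ℝ | ENNReal.ofReal τ < a} :=
    measurableSet_lt ENNReal.measurable_ofReal measurable_const
  rw [h1, lintegral_indicator_one hm, Measure.restrict_apply hm]
  induction a with
  | top =>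
    have : {τ : ℝ | ENNReal.ofReal τ < ⊤} ∩ Ioi 0 = Ioi 0 := by ext; simp
    rw [this]; simp
  | coe a =>
    have : {τ : ℝ | ENNReal.ofReal τ < a} ∩ Ioi 0 = Ioo 0 (a:ℝ) := by
      ext τ
      simp only [mem_inter_iff, mem_ofPred_eq, mem_Ioi, mem_Ioo]
      constructor
      · rintro ⟨h, h0⟩
        refine ⟨h0, ?_⟩
        rw [← ENNReal.ofReal_coe_nnreal, ENNReal.ofReal_lt_ofReal_iff'] at h
        exact h.1
      · rintro ⟨h0, h⟩
        refine ⟨?_, h0⟩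
        rw [← ENNReal.ofReal_coe_nnreal, ENNReal.ofReal_lt_ofReal_iff']
        exact ⟨h, h0.trans h⟩
    rw [this]; simp

lemma aux_layer {X : Type*} [MeasurableSpace X] (ρ : Measure X) [SFinite ρ] (f : X → ℝ≥0∞)
    (hf : Measurable f) :
    ∫⁻ z, f z ∂ρ = ∫⁻ τ in Ioi (0:ℝ), ρ {z | ENNReal.ofReal τ < f z} := by
  have hm : Measurable (fun p : X × ℝ => (if ENNReal.ofReal p.2 < f p.1 then (1:ℝ≥0∞) else 0)) := by
    refine Measurable.ite (measurableSet_lt (ENNReal.measurable_ofReal.comp measurable_snd)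
      (hf.comp measurable_fst)) measurable_const measurable_const
  calc ∫⁻ z, f z ∂ρ = ∫⁻ z, (∫⁻ τ in Ioi (0:ℝ), (if ENNReal.ofReal τ < f z then (1:ℝ≥0∞) else 0)) ∂ρ := by
        simp_rw [aux_layer_pt]
    _ = ∫⁻ τ in Ioi (0:ℝ), ∫⁻ z, (if ENNReal.ofReal τ < f z then (1:ℝ≥0∞) else 0) ∂ρ := by
        rw [lintegral_lintegral_swap hm.aemeasurable]
    _ = _ := by
        congr 1; ext τ
        have h1 : (fun z => (if ENNReal.ofReal τ < f z then (1:ℝ≥0∞) else 0))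
            = indicator {z | ENNReal.ofReal τ < f z} 1 := by
          ext τ; simp [indicator]
        rw [h1, lintegral_indicator_one (measurableSet_lt measurable_const hf)]

lemma aux_dom {X : Type*} [MeasurableSpace X] (l ρ : Measure X) [SFinite l] [SFinite ρ]
    (f g : X → ℝ≥0∞) (hf : Measurable f) (hg : Measurable g) (s : ℝ≥0∞) (hs : s ≠ ∞)
    (h : ∀ τ : ℝ, 0 < τ → l {z | ENNReal.ofReal τ < f z} ≤ s * ρ {z | ENNReal.ofReal τ < g z}) :
    ∫⁻ z, f z ∂l ≤ s * ∫⁻ z, g z ∂ρ := by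
  rw [aux_layer l f hf, aux_layer ρ g hg, ← lintegral_const_mul' _ _ hs]
  exact setLIntegral_mono' measurableSet_Ioi (fun τ hτ => h τ hτ)

lemma aux_vitali {X : Type*} [MeasurableSpace X] (D : X → X → ℝ≥0∞)
    (hDm : ∀ x, Measurable (D x)) (hsymm : ∀ x y, D x y = D y x) (C : ℝ) (hC : 0 < C)
    (tri : ∀ x y z, D x y ≤ ENNReal.ofReal C * (D x z + D z y))
    (l ρ : Measure X) [IsFiniteMeasure l] (s : ℝ) (hs : 0 < s) :
    ρ {y | ∃ r : ℝ, 0 < r ∧ ENNReal.ofReal s * ρ {z | D y z < ENNReal.ofReal (3 * C * r)}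
      < l {z | D y z < ENNReal.ofReal r}} ≤ (ENNReal.ofReal s)⁻¹ * l univ := by
  set P : X → ℝ → Prop := fun y r => 0 < r ∧
    ENNReal.ofReal s * ρ {z | D y z < ENNReal.ofReal (3 * C * r)} < l {z | D y z < ENNReal.ofReal r}
  let E : ℕ → Set X := fun n => {y | ∃ r : ℝ, r ≤ n ∧ P y r}
  have hE : {y | ∃ r, P y r} = ⋃ n, E n := by
    ext y
    simp only [mem_ofPred_eq, mem_iUnion, E]
    constructor
    · rintro ⟨r, hr⟩
      obtain ⟨n, hn⟩ := exists_nat_ge r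
      exact ⟨n, r, hn, hr⟩
    · rintro ⟨n, r, _, hr⟩; exact ⟨r, hr⟩
  have hmono : Monotone E := by
    intro a b hab y
    rintro ⟨r, hr, hp⟩
    exact ⟨r, hr.trans (by exact_mod_cast hab), hp⟩
  change ρ {y | ∃ r, P y r} ≤ _
  rw [hE, hmono.measure_iUnion]
  refine iSup_le fun n => ?_
  let B : X × ℝ → Set X := fun p => {z | D p.1 z < ENNReal.ofReal p.2}
  have hBm : ∀ p, MeasurableSet (B p) := fun p => measurableSet_lt (hDm _) measurable_const
  obtain ⟨u, hut, hdis, hcov⟩ := Vitali.exists_disjoint_subfamily_covering_enlargement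
    B {p : X × ℝ | p.2 ≤ n ∧ P p.1 p.2} (fun p => p.2) 2 (by norm_num)
    (fun p hp => hp.2.1.le) n (fun p hp => hp.1) (by
      rintro p ⟨_, hp⟩
      have : 0 < l (B p) := lt_of_le_of_lt (zero_le) hp.2
      exact nonempty_of_measure_ne_zero this.ne')
  have hcount : u.Countable := by
    have := Measure.countable_meas_pos_of_disjoint_iUnion (μ := l) (As := fun p : u => B p)
      (fun p => hBm p) (by
        intro a b hab
        exact hdis a.2 b.2 (fun h => hab (Subtype.ext h)))
    have hh : {i : u | 0 < l (B i)} = univ := by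
      ext i; simp only [mem_ofPred_eq, mem_univ, iff_true]
      exact lt_of_le_of_lt (zero_le) (hut i.2).2.2
    rw [hh] at this
    exact countable_univ_iff.1 this
  have := hcount.to_subtype
  have hsub : E n ⊆ ⋃ p : u, {z | D p.1.1 z < ENNReal.ofReal (3 * C * p.1.2)} := by
    rintro y ⟨r, hr, hp⟩
    obtain ⟨b, hb, ⟨z, hz1, hz2⟩, hle⟩ := hcov (y, r) ⟨hr, hp⟩
    refine mem_iUnion.2 ⟨⟨b, hb⟩, ?_⟩
    simp only [mem_ofPred_eq, B] at hz1 hz2 hle ⊢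
    have hb0 : 0 < b.2 := (hut hb).2.1
    calc D b.1 y ≤ ENNReal.ofReal C * (D b.1 z + D z y) := tri _ _ _
      _ < ENNReal.ofReal C * (ENNReal.ofReal b.2 + ENNReal.ofReal r) := by
          rw [hsymm z y]
          exact ENNReal.mul_lt_mul_right (by simpa using hC) (by simp) (ENNReal.add_lt_add hz2 hz1)
      _ = ENNReal.ofReal (C * (b.2 + r)) := by
          rw [ENNReal.ofReal_mul hC.le, ENNReal.ofReal_add hb0.le hp.1.le]
      _ ≤ _ := by
          apply ENNReal.ofReal_le_ofReal
          nlinarith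
  have hs0 : ENNReal.ofReal s ≠ 0 := by simpa using hs
  calc ρ (E n) ≤ ∑' p : u, ρ {z | D p.1.1 z < ENNReal.ofReal (3 * C * p.1.2)} :=
        (measure_mono hsub).trans (measure_iUnion_le _)
    _ ≤ ∑' p : u, (ENNReal.ofReal s)⁻¹ * l (B p) := by
        refine ENNReal.tsum_le_tsum fun p => ?_
        rw [mul_comm (ENNReal.ofReal s)⁻¹, ← div_eq_mul_inv, ENNReal.le_div_iff_mul_le (Or.inl hs0) (Or.inl (by simp)), mul_comm]
        exact (hut p.2).2.2.le
    _ = (ENNReal.ofReal s)⁻¹ * l (⋃ p : u, B p) := by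
        rw [ENNReal.tsum_mul_left, measure_iUnion (f := fun p : u => B p) _ (fun p => hBm p)]
        intro a b hab
        exact hdis a.2 b.2 (fun h => hab (Subtype.ext h))
    _ ≤ _ := by gcongr; exact subset_univ _

lemma aux_weak {X : Type*} [MeasurableSpace X] (D : X → X → ℝ≥0∞)
    (hDm : ∀ x, Measurable (D x)) (hsymm : ∀ x y, D x y = D y x) (C : ℝ) (hC : 0 < C)
    (tri : ∀ x y z, D x y ≤ ENNReal.ofReal C * (D x z + D z y))
    (l ρ : Measure X) [IsFiniteMeasure l] [SFinite ρ] (T : ℝ) (hT : 0 < T) :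
    ρ {y | ENNReal.ofReal T * ∫⁻ z, (D y z)⁻¹ ∂ρ < ∫⁻ z, (D y z)⁻¹ ∂l}
      ≤ ENNReal.ofReal (3 * C / T) * l univ := by
  have h := aux_vitali D hDm hsymm C hC tri l ρ (T / (3 * C)) (by positivity)
  rw [← ENNReal.ofReal_inv_of_pos (by positivity), inv_div] at h
  refine (measure_mono ?_).trans h
  intro y hy
  by_contra hcon
  simp only [mem_ofPred_eq, not_exists, not_and, not_lt] at hcon hy
  apply hy.not_ge
  have := aux_dom l ρ (fun z => (D y z)⁻¹) (fun z => ENNReal.ofReal (3 * C) * (D y z)⁻¹)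
    (hDm y).inv ((hDm y).inv.const_mul _) (ENNReal.ofReal (T / (3 * C))) (by simp) (by
      intro τ hτ
      have h1 := hcon τ⁻¹ (by positivity)
      have e1 : ∀ t : ℝ, 0 < t → ∀ a : ℝ≥0∞, ENNReal.ofReal t < a⁻¹ ↔ a < ENNReal.ofReal t⁻¹ := by
        intro t ht a
        rw [ENNReal.lt_inv_iff_lt_inv, ENNReal.ofReal_inv_of_pos ht]
      have e2 : {z | ENNReal.ofReal τ < (D y z)⁻¹} = {z | D y z < ENNReal.ofReal τ⁻¹} := by
        ext z; exact e1 τ hτ _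
      have e3 : {z | ENNReal.ofReal τ < ENNReal.ofReal (3 * C) * (D y z)⁻¹}
          = {z | D y z < ENNReal.ofReal (3 * C * τ⁻¹)} := by
        ext z
        simp only [mem_ofPred_eq]
        have := e1 (τ / (3 * C)) (by positivity) (D y z)
        rw [inv_div] at this
        rw [← div_eq_mul_inv (3 * C) τ, ← this, ENNReal.ofReal_div_of_pos (by positivity), ENNReal.div_lt_iff,
          mul_comm (D y z)⁻¹]
        · left; simpa using hC
        · left; exact ENNReal.ofReal_ne_top
      rw [e2, e3]
      exact h1)
  refine this.trans (le_of_eq ?_)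
  rw [lintegral_const_mul' _ _ ENNReal.ofReal_ne_top, ← mul_assoc, ← ENNReal.ofReal_mul (by positivity)]
  congr 2
  field_simp



lemma aux_ptol (K yz yw wz xy xz xw : ℝ≥0∞) (h1 : yz ≤ K * (yw + wz))
    (h2 : yz ≤ K * (xy + xz)) (h3 : xw ≤ K * (xz + wz)) (h4 : xw ≤ K * (xy + yw)) :
    yz * xw ≤ 4 * K ^ 2 * (yw * xz + wz * xy) := by
  rcases le_total wz yw with h | h
  · rcases le_total wz xz with h' | h'
    · calc yz * xw ≤ (K * (yw + yw)) * (K * (xz + xz)) := by gcongr <;> [exact h1.trans (by gcongr); exact h3.trans (by gcongr)]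
        _ = 4 * K ^ 2 * (yw * xz) := by ring
        _ ≤ _ := by gcongr; exact le_self_add
    · calc yz * xw ≤ (K * (xy + xz)) * (K * (wz + wz)) := by gcongr; exact h3.trans (by gcongr)
        _ = 2 * K ^ 2 * (wz * xz + wz * xy) := by ring
        _ ≤ _ := by gcongr; norm_num
  · rcases le_total yw xy with h' | h'
    · calc yz * xw ≤ (K * (wz + wz)) * (K * (xy + xy)) := by gcongr <;> [exact h1.trans (by gcongr); exact h4.trans (by gcongr)]
        _ = 4 * K ^ 2 * (wz * xy) := by ring
        _ ≤ _ := by gcongr; exact le_add_self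
    · calc yz * xw ≤ (K * (xy + xz)) * (K * (yw + yw)) := by gcongr; exact h4.trans (by gcongr)
        _ = 2 * K ^ 2 * (yw * xz + yw * xy) := by ring
        _ ≤ _ := by gcongr; norm_num

lemma aux_const (q : ℝ) (hq1 : q < 1) (c : ℝ) (hc : 0 < c) :
    ∃ K : ℝ, 0 < K ∧ ∑' j : ℕ, (ENNReal.ofReal (2 ^ (j + 1) * K)) ^ q *
      ENNReal.ofReal (c / (2 ^ j * K)) ≤ 1 / 2 := by
  have hlim : Filter.Tendsto (fun K : ℝ => K ^ (-(1 - q))) Filter.atTop (nhds 0) :=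
    tendsto_rpow_neg_atTop (by linarith)
  set r : ℝ := 2 ^ (q - 1) with hr
  have hr0 : 0 < r := by positivity
  have hr1 : r < 1 := Real.rpow_lt_one_of_one_lt_of_neg (by norm_num) (by linarith)
  have h2 := hlim.const_mul (2 ^ q * c * (1 - r)⁻¹)
  rw [mul_zero] at h2
  obtain ⟨K, hK, hK0⟩ := ((h2.eventually (gt_mem_nhds (show (0:ℝ) < 1/2 by norm_num))).and
    (Filter.eventually_gt_atTop 0)).exists
  refine ⟨K, hK0, ?_⟩
  have e : ∀ j : ℕ, (ENNReal.ofReal (2 ^ (j + 1) * K)) ^ q *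
      ENNReal.ofReal (c / (2 ^ j * K)) = ENNReal.ofReal (2 ^ q * c * K ^ (-(1 - q)) * r ^ j) := by
    intro j
    rw [ENNReal.ofReal_rpow_of_pos (by positivity), ← ENNReal.ofReal_mul (by positivity)]
    congr 1
    rw [Real.mul_rpow (by positivity) hK0.le, pow_succ, Real.mul_rpow (by positivity) (by norm_num)]
    have e1 : r ^ j = ((2:ℝ) ^ j) ^ q / 2 ^ j := by
      rw [hr, Real.rpow_sub (by norm_num), Real.rpow_one, div_pow, ← Real.rpow_natCast,
        ← Real.rpow_mul (by norm_num), mul_comm q, Real.rpow_mul (by norm_num), Real.rpow_natCast]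
    have e2 : K ^ (-(1 - q)) = K ^ q / K := by
      rw [neg_sub, Real.rpow_sub hK0, Real.rpow_one]
    rw [e1, e2]
    field_simp
  simp_rw [e]
  have hs : Summable (fun j : ℕ => 2 ^ q * c * K ^ (-(1 - q)) * r ^ j) :=
    (summable_geometric_of_lt_one hr0.le hr1).mul_left _
  rw [← ENNReal.ofReal_tsum_of_nonneg (fun j => by positivity) hs, tsum_mul_left,
    tsum_geometric_of_lt_one hr0.le hr1]
  rw [show (1:ℝ≥0∞)/2 = ENNReal.ofReal (1/2) by
    rw [ENNReal.ofReal_div_of_pos (by norm_num)]; simp]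
  apply ENNReal.ofReal_le_ofReal
  nlinarith

lemma aux_pt (q : ℝ) (hq : 0 < q) (K : ℝ) (hK : 0 < K) (u v : ℝ≥0∞) (hu : u ≠ 0) (hv : v ≠ ∞) :
    v ^ q ≤ ENNReal.ofReal K ^ q * u ^ q + ∑' j : ℕ, (ENNReal.ofReal (2 ^ (j + 1) * K)) ^ q *
      (if ENNReal.ofReal (2 ^ j * K) * u < v then u ^ q else 0) := by
  classical
  by_cases h : v ≤ ENNReal.ofReal K * u
  · rw [← ENNReal.mul_rpow_of_nonneg _ _ hq.le]
    exact (ENNReal.rpow_le_rpow h hq.le).trans le_self_add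
  · have hex : ∃ n : ℕ, v ≤ ENNReal.ofReal (2 ^ n * K) * u := by
      have hKu : ENNReal.ofReal K * u ≠ 0 := mul_ne_zero (by simpa using hK) hu
      have : v / (ENNReal.ofReal K * u) ≠ ∞ := (ENNReal.div_lt_top hv hKu).ne
      obtain ⟨n, hn⟩ := ENNReal.exists_nat_gt this
      refine ⟨n, ?_⟩
      have hn2 : v ≤ n * (ENNReal.ofReal K * u) := ENNReal.div_le_iff_le_mul (Or.inl hKu) (Or.inr (by simpa using fun h => by simp_all)) |>.1 hn.le
      refine hn2.trans ?_
      rw [ENNReal.ofReal_mul (by positivity), ← mul_assoc]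
      gcongr
      rw [← ENNReal.ofReal_natCast]
      apply ENNReal.ofReal_le_ofReal
      exact_mod_cast (Nat.lt_two_pow_self).le
    obtain ⟨j, hj⟩ : ∃ j, Nat.find hex = j + 1 := by
      apply Nat.exists_eq_succ_of_ne_zero
      intro h0
      have := Nat.find_spec hex
      rw [h0] at this
      apply h; simpa using this
    have h1 : v ≤ ENNReal.ofReal (2 ^ (j + 1) * K) * u := hj ▸ Nat.find_spec hex
    have h2 : ¬ v ≤ ENNReal.ofReal (2 ^ j * K) * u := Nat.find_min hex (by omega)
    refine le_trans ?_ (le_trans (ENNReal.le_tsum j) le_add_self)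
    rw [if_pos (not_le.1 h2), ← ENNReal.mul_rpow_of_nonneg _ _ hq.le]
    exact ENNReal.rpow_le_rpow h1 hq.le

lemma aux_iter {X : Type*} [MeasurableSpace X] (σ : Measure X) (q C : ℝ) (hq0 : 0 < q) (hq1 : q < 1)
    (hC : 0 < C) (u v : X → ℝ≥0∞)
    (h0 : ∀ᵐ x ∂σ, v x ≤ ENNReal.ofReal C * u x)
    (hstep : ∀ c : ℝ, 1 ≤ c → (∀ᵐ x ∂σ, v x ≤ ENNReal.ofReal c * u x) →
      ∀ᵐ x ∂σ, v x ≤ ENNReal.ofReal (c ^ q) * u x) : ∀ᵐ x ∂σ, v x ≤ u x := by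
  have hn : ∀ n : ℕ, ∀ᵐ x ∂σ, v x ≤ ENNReal.ofReal ((max C 1) ^ (q ^ n)) * u x := by
    intro n
    induction n with
    | zero =>
      filter_upwards [h0] with x hx
      refine hx.trans ?_
      gcongr
      simp
    | succ n ih =>
      have := hstep _ (Real.one_le_rpow (le_max_right _ _) (by positivity)) ih
      rwa [← Real.rpow_mul (by positivity), ← pow_succ] at this
  filter_upwards [ae_all_iff.2 hn] with x hx
  have hlim : Filter.Tendsto (fun n : ℕ => ENNReal.ofReal ((max C 1) ^ (q ^ n)) * u x)
      Filter.atTop (nhds (1 * u x)) := by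
    apply ENNReal.Tendsto.mul_const _ (Or.inl one_ne_zero)
    rw [← ENNReal.ofReal_one]
    apply ENNReal.tendsto_ofReal
    have h1 : (max C 1 : ℝ) ≠ 0 := by positivity
    have := (Real.continuousAt_const_rpow (b := (0:ℝ)) h1).tendsto.comp
      (tendsto_pow_atTop_nhds_zero_of_lt_one hq0.le hq1)
    simpa [Function.comp_def] using this
  rw [one_mul] at hlim
  exact ge_of_tendsto' hlim hx

lemma aux_compare [SecondCountableTopology Ω]
    [BorelSpace Ω] (G : Ω → Ω → ℝ≥0∞) (κ q : ℝ) (hq0 : 0 < q) (hq1 : q < 1)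
    (μ σ : Measure Ω) [SFinite μ] [SFinite σ]
    (hG : IsQuasiMetricKernel G κ) :
    ∃ C : ℝ, 0 < C ∧ ∀ u v : Ω → ℝ≥0∞, IsSol G σ q (pot G μ) u → IsSol G σ q (pot G μ) v →
      ∀ᵐ x ∂σ, v x ≤ ENNReal.ofReal C * u x := by
  obtain ⟨hk, hκ, hpos, hsymm, htri⟩ := hG
  have hGm : Measurable (fun p : Ω × Ω => G p.1 p.2) := LowerSemicontinuous.measurable hk
  have hGy : ∀ y, Measurable (G y) := fun y => hGm.comp measurable_prodMk_left
  have hκ0 : 0 < κ := by linarith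
  obtain ⟨K, hK0, hK⟩ := aux_const q hq1 (3 * (4 * κ ^ 2)) (by positivity)
  refine ⟨2 * (K ^ q + 1), by positivity, ?_⟩
  intro u v ⟨hum, hu0, hu⟩ ⟨hvm, hv0, hv⟩
  filter_upwards [hu, hv] with x hxu hxv
  set m : Ω → ℝ≥0∞ := G x with hm
  have hmm : Measurable m := hGy x
  have hm0 : ∀ y, m y ≠ 0 := fun y => (hpos x y).ne'
  have huqm : Measurable (fun y => u y ^ q) := hum.pow_const q
  have hvqm : Measurable (fun y => v y ^ q) := hvm.pow_const q
  -- a.e. finiteness of m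
  have hvfin : potF G σ (fun y => v y ^ q) x + pot G μ x < ∞ := by rw [← hxv.1]; exact hxv.2
  have hSσ : ∀ᵐ y ∂σ, m y < ∞ := by
    have h1 : ∫⁻ y, m y * v y ^ q ∂σ ≠ ∞ := (lt_of_le_of_lt le_self_add hvfin).ne
    filter_upwards [ae_lt_top (hmm.mul hvqm) h1, hv0] with y hy hy0
    rw [lt_top_iff_ne_top]
    intro hcon
    have : v y ^ q ≠ 0 := (ENNReal.rpow_pos_of_nonneg hy0 hq0.le).ne'
    rw [Pi.mul_apply, hcon, ENNReal.top_mul this] at hy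
    exact lt_irrefl _ hy
  have hSμ : ∀ᵐ y ∂μ, m y < ∞ :=
    ae_lt_top hmm (lt_of_le_of_lt le_add_self hvfin).ne
  -- modified quasi-metric
  classical
  let D : Ω → Ω → ℝ≥0∞ := fun y z =>
    if m y < ∞ ∧ m z < ∞ then (G y z)⁻¹ * (m y * m z) else ∞
  have hDm : ∀ y, Measurable (D y) := by
    intro y
    refine Measurable.ite ?_ ((hGy y).inv.mul (hmm.const_mul _)) measurable_const
    exact (MeasurableSet.const _).inter (measurableSet_lt hmm measurable_const)
  have hDs : ∀ y z, D y z = D z y := by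
    intro y z
    simp only [D, and_comm (a := m y < ∞), hsymm y z, mul_comm (m y)]
  have hDt : ∀ y z w, D y z ≤ ENNReal.ofReal (4 * κ ^ 2) * (D y w + D w z) := by
    intro y z w
    have hc0 : ENNReal.ofReal (4 * κ ^ 2) ≠ 0 := by
      rw [Ne, ENNReal.ofReal_eq_zero, not_le]; positivity
    by_cases hw : m w < ∞
    swap
    · simp only [D, hw, and_false, false_and, if_false, top_add, add_top, ENNReal.mul_top hc0, le_top]
    by_cases hy : m y < ∞
    swap
    · simp only [D, hy, and_false, false_and, if_false, top_add, add_top, ENNReal.mul_top hc0, le_top]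
    by_cases hz : m z < ∞
    swap
    · simp only [D, hz, and_false, false_and, if_false, top_add, add_top, ENNReal.mul_top hc0, le_top]
    simp only [D, hw, hy, hz, and_self, if_true]
    have hp := aux_ptol (ENNReal.ofReal κ) (G y z)⁻¹ (G y w)⁻¹ (G w z)⁻¹ (m y)⁻¹ (m z)⁻¹ (m w)⁻¹
      (htri y z w) (by simpa only [hm, hsymm y x] using htri y z x)
      (by simpa only [hm, hsymm z w] using htri x w z) (htri x w y)
    have cy := ENNReal.mul_inv_cancel (hm0 y) hy.ne
    have cz := ENNReal.mul_inv_cancel (hm0 z) hz.ne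
    have cw := ENNReal.mul_inv_cancel (hm0 w) hw.ne
    rw [show ENNReal.ofReal (4 * κ ^ 2) = 4 * ENNReal.ofReal κ ^ 2 by
      rw [ENNReal.ofReal_mul (by norm_num), ENNReal.ofReal_pow hκ0.le]; norm_num]
    calc (G y z)⁻¹ * (m y * m z) = ((G y z)⁻¹ * (m w)⁻¹) * (m y * m z * m w) := by
          rw [show ((G y z)⁻¹ * (m w)⁻¹) * (m y * m z * m w)
            = (G y z)⁻¹ * (m y * m z) * (m w * (m w)⁻¹) by ring, cw, mul_one]
      _ ≤ (4 * ENNReal.ofReal κ ^ 2 * ((G y w)⁻¹ * (m z)⁻¹ + (G w z)⁻¹ * (m y)⁻¹))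
            * (m y * m z * m w) := by gcongr
      _ = 4 * ENNReal.ofReal κ ^ 2 * ((G y w)⁻¹ * (m y * m w) * (m z * (m z)⁻¹)
            + (G w z)⁻¹ * (m w * m z) * (m y * (m y)⁻¹)) := by ring
      _ = _ := by rw [cy, cz, mul_one, mul_one]
  -- measures
  set τ := σ.withDensity m with hτ
  set ρ := τ.withDensity (fun y => u y ^ q) with hρ
  set l := τ.withDensity (fun y => v y ^ q) + μ.withDensity m with hl
  have hτσ : τ ≪ σ := withDensity_absolutelyContinuous _ _
  have hρσ : ρ ≪ σ := (withDensity_absolutelyContinuous _ _).trans hτσ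
  have hlu : l univ = v x := by
    rw [hl, Measure.add_apply, withDensity_apply _ MeasurableSet.univ,
      withDensity_apply _ MeasurableSet.univ, Measure.restrict_univ, Measure.restrict_univ, hτ,
      lintegral_withDensity_eq_lintegral_mul _ hmm hvqm, hxv.1]
    rfl
  have hρu : ρ univ ≤ u x := by
    rw [hρ, withDensity_apply _ MeasurableSet.univ, Measure.restrict_univ, hτ,
      lintegral_withDensity_eq_lintegral_mul _ hmm huqm, hxu.1]
    exact le_self_add
  have : IsFiniteMeasure l := ⟨by rw [hlu]; exact hxv.2⟩
  have hDinv : ∀ y z, m y < ∞ → m z < ∞ → m y * (m z * (D y z)⁻¹) = G y z := by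
    intro y z hy hz
    have cy := ENNReal.mul_inv_cancel (hm0 y) hy.ne
    have cz := ENNReal.mul_inv_cancel (hm0 z) hz.ne
    simp only [D, hy, hz, and_self, if_true]
    have hyz0 : m y * m z ≠ 0 := mul_ne_zero (hm0 y) (hm0 z)
    have hyzt : m y * m z ≠ ∞ := ENNReal.mul_ne_top hy.ne hz.ne
    rw [ENNReal.mul_inv (Or.inr hyzt) (Or.inr hyz0), inv_inv,
      show m y * (m z * (G y z * (m y * m z)⁻¹)) = G y z * ((m y * m z) * (m y * m z)⁻¹) by ring,
      ENNReal.mul_inv_cancel hyz0 hyzt, mul_one]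
  have hDi : ∀ y, Measurable (fun z => (D y z)⁻¹) := fun y => (hDm y).inv
  have hint : ∀ y, m y < ∞ → ∀ f : Ω → ℝ≥0∞, Measurable f →
      m y * ∫⁻ z, (D y z)⁻¹ ∂(τ.withDensity f) = potF G σ f y := by
    intro y hy f hf
    rw [lintegral_withDensity_eq_lintegral_mul _ hf (hDi y), hτ,
      lintegral_withDensity_eq_lintegral_mul _ hmm (hf.mul (hDi y)),
      ← lintegral_const_mul' _ _ hy.ne]
    apply lintegral_congr_ae
    filter_upwards [hSσ] with z hz
    simp only [Pi.mul_apply]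
    rw [← hDinv y z hy hz]
    ring
  have hintμ : ∀ y, m y < ∞ → m y * ∫⁻ z, (D y z)⁻¹ ∂(μ.withDensity m) = pot G μ y := by
    intro y hy
    rw [lintegral_withDensity_eq_lintegral_mul _ hmm (hDi y),
      ← lintegral_const_mul' _ _ hy.ne]
    apply lintegral_congr_ae
    filter_upwards [hSμ] with z hz
    simp only [Pi.mul_apply]
    rw [← hDinv y z hy hz]
  have hweak : ∀ T : ℝ, 0 < T → ρ {y | ENNReal.ofReal T * u y < v y}
      ≤ ENNReal.ofReal (3 * (4 * κ ^ 2) / T) * v x := by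
    intro T hT
    rw [← hlu]
    refine le_trans (measure_mono_ae ?_)
      (aux_weak D hDm hDs (4 * κ ^ 2) (by positivity) hDt l ρ T hT)
    filter_upwards [hρσ.ae_le hSσ, hρσ.ae_le hu, hρσ.ae_le hv] with y hy huy hvy
    intro hlt
    change ENNReal.ofReal T * u y < v y at hlt
    change ENNReal.ofReal T * ∫⁻ z, (D y z)⁻¹ ∂ρ < ∫⁻ z, (D y z)⁻¹ ∂l
    have e1 : m y * ∫⁻ z, (D y z)⁻¹ ∂ρ ≤ u y := by
      rw [hint y hy _ huqm, huy.1]; exact le_self_add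
    have e2 : m y * ∫⁻ z, (D y z)⁻¹ ∂l = v y := by
      rw [hl, lintegral_add_measure, mul_add, hint y hy _ hvqm, hintμ y hy, ← hvy.1]
    by_contra hcon
    rw [not_lt] at hcon
    apply hlt.not_ge
    calc v y = m y * ∫⁻ z, (D y z)⁻¹ ∂l := e2.symm
      _ ≤ m y * (ENNReal.ofReal T * ∫⁻ z, (D y z)⁻¹ ∂ρ) := by gcongr
      _ = ENNReal.ofReal T * (m y * ∫⁻ z, (D y z)⁻¹ ∂ρ) := by ring
      _ ≤ _ := by gcongr
  have hFm : ∀ j : ℕ, MeasurableSet {y | ENNReal.ofReal (2 ^ j * K) * u y < v y} :=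
    fun j => measurableSet_lt (hum.const_mul _) hvm
  have hmain : ∫⁻ y, v y ^ q ∂τ ≤ ENNReal.ofReal K ^ q * u x + 1 / 2 * v x := by
    calc ∫⁻ y, v y ^ q ∂τ ≤ ∫⁻ y, (ENNReal.ofReal K ^ q * u y ^ q +
          ∑' j : ℕ, (ENNReal.ofReal (2 ^ (j + 1) * K)) ^ q *
          (if ENNReal.ofReal (2 ^ j * K) * u y < v y then u y ^ q else 0)) ∂τ := by
          apply lintegral_mono_ae
          filter_upwards [hτσ.ae_le hu0, hτσ.ae_le hv] with y hy hvy
          exact aux_pt q hq0 K hK0 _ _ hy.ne' hvy.2.ne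
      _ = ENNReal.ofReal K ^ q * ∫⁻ y, u y ^ q ∂τ + ∑' j : ℕ,
          (ENNReal.ofReal (2 ^ (j + 1) * K)) ^ q * ρ {y | ENNReal.ofReal (2 ^ j * K) * u y < v y} := by
          rw [lintegral_add_left (huqm.const_mul _), lintegral_const_mul _ huqm, lintegral_tsum]
          · congr 2
            ext j
            have hmi : Measurable (fun y => if ENNReal.ofReal (2 ^ j * K) * u y < v y then u y ^ q else 0) :=
              Measurable.ite (hFm j) huqm measurable_const
            rw [lintegral_const_mul _ hmi, hρ, withDensity_apply _ (hFm j),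
              ← lintegral_indicator (hFm j)]
            congr 2
            ext a
            simp [indicator]
          · intro j
            exact ((Measurable.ite (hFm j) huqm measurable_const).const_mul _).aemeasurable
      _ ≤ ENNReal.ofReal K ^ q * u x + ∑' j : ℕ,
          (ENNReal.ofReal (2 ^ (j + 1) * K)) ^ q *
            (ENNReal.ofReal (3 * (4 * κ ^ 2) / (2 ^ j * K)) * v x) := by
          gcongr with j
          · rw [hρ, withDensity_apply _ MeasurableSet.univ, Measure.restrict_univ] at hρu
            exact hρu
          · exact hweak _ (by positivity)
      _ ≤ _ := by
          have e : ∀ j : ℕ, (ENNReal.ofReal (2 ^ (j + 1) * K)) ^ q *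
            (ENNReal.ofReal (3 * (4 * κ ^ 2) / (2 ^ j * K)) * v x) =
            (ENNReal.ofReal (2 ^ (j + 1) * K)) ^ q *
            ENNReal.ofReal (3 * (4 * κ ^ 2) / (2 ^ j * K)) * v x := fun j => (mul_assoc _ _ _).symm
          rw [tsum_congr e, ENNReal.tsum_mul_right]
          gcongr
  have hvx : v x ≤ ENNReal.ofReal K ^ q * u x + 1 / 2 * v x + u x := by
    have e1 : v x = ∫⁻ y, v y ^ q ∂τ + pot G μ x := by
      rw [hτ, lintegral_withDensity_eq_lintegral_mul _ hmm hvqm, hxv.1]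
      rfl
    refine e1.le.trans (add_le_add hmain ?_)
    rw [hxu.1]; exact le_add_self
  have hut := hxu.2
  have hvt := hxv.2
  rw [ENNReal.ofReal_rpow_of_pos hK0] at hvx
  lift u x to NNReal using hut.ne with a
  lift v x to NNReal using hvt.ne with b
  have hh : (b : ℝ) ≤ K ^ q * a + 1 / 2 * b + a := by
    have hKq : 0 ≤ K ^ q := by positivity
    have : (b : ℝ≥0∞) = ENNReal.ofReal b := by simp
    have h2 : (1 / 2 : ℝ≥0∞) = ENNReal.ofReal (1 / 2) := by
      rw [ENNReal.ofReal_div_of_pos (by norm_num)]; simp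
    rw [h2, ← ENNReal.ofReal_coe_nnreal (p := a), ← ENNReal.ofReal_coe_nnreal (p := b),
      ← ENNReal.ofReal_mul hKq, ← ENNReal.ofReal_mul (by norm_num),
      ← ENNReal.ofReal_add (by positivity) (by positivity),
      ← ENNReal.ofReal_add (by positivity) (by positivity),
      ENNReal.ofReal_le_ofReal_iff (by positivity)] at hvx
    exact hvx
  rw [← ENNReal.ofReal_coe_nnreal (p := a), ← ENNReal.ofReal_coe_nnreal (p := b),
    ← ENNReal.ofReal_mul (by positivity)]
  apply ENNReal.ofReal_le_ofReal
  linarith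

lemma aux_le [SecondCountableTopology Ω]
    [BorelSpace Ω] (G : Ω → Ω → ℝ≥0∞) (κ q : ℝ) (hq0 : 0 < q) (hq1 : q < 1)
    (μ σ : Measure Ω) [SFinite μ] [SFinite σ]
    (hG : IsQuasiMetricKernel G κ) (u v : Ω → ℝ≥0∞) (hu : IsSol G σ q (pot G μ) u)
    (hv : IsSol G σ q (pot G μ) v) : ∀ᵐ x ∂σ, v x ≤ u x := by
  obtain ⟨C, hC, h⟩ := aux_compare G κ q hq0 hq1 μ σ hG
  refine aux_iter σ q C hq0 hq1 hC u v (h u v hu hv) ?_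
  intro c hc hvc
  filter_upwards [hu.2.2, hv.2.2] with x hxu hxv
  rw [hxu.1, hxv.1, mul_add]
  have h1 : (1 : ℝ≥0∞) ≤ ENNReal.ofReal (c ^ q) := by
    rw [← ENNReal.ofReal_one]
    exact ENNReal.ofReal_le_ofReal (Real.one_le_rpow hc hq0.le)
  refine add_le_add ?_ (le_mul_of_one_le_left (zero_le) h1)
  unfold potF
  rw [← lintegral_const_mul' _ _ ENNReal.ofReal_ne_top]
  apply lintegral_mono_ae
  filter_upwards [hvc] with y hy
  rw [mul_left_comm]
  gcongr
  rw [← ENNReal.ofReal_rpow_of_pos (by linarith), ← ENNReal.mul_rpow_of_nonneg _ _ hq0.le]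
  exact ENNReal.rpow_le_rpow hy hq0.le

/-- uniqueness, σ-a.e., of nontrivial solutions of `u = G(u^q dσ) + Gμ`
for a quasi-metric kernel. -/
theorem statement4 [LocallyCompactSpace Ω] [T2Space Ω] [SecondCountableTopology Ω]
    [BorelSpace Ω] (G : Ω → Ω → ℝ≥0∞) (κ q : ℝ) (hq0 : 0 < q) (hq1 : q < 1)
    (μ σ : Measure Ω) [IsLocallyFiniteMeasure μ] [IsLocallyFiniteMeasure σ] (hσ : σ ≠ 0)
    (hG : IsQuasiMetricKernel G κ)
    (u₁ u₂ : Ω → ℝ≥0∞) (h₁ : IsSol G σ q (pot G μ) u₁) (h₂ : IsSol G σ q (pot G μ) u₂) :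
    u₁ =ᵐ[σ] u₂ := by
  filter_upwards [aux_le G κ q hq0 hq1 μ σ hG u₁ u₂ h₁ h₂, aux_le G κ q hq0 hq1 μ σ hG u₂ u₁ h₂ h₁]
    with x hx1 hx2
  exact le_antisymm hx2 hx1

end NPE
end
end

section
/- Let Ω be a locally compact Hausdorff space with countable base, 0 < q < 1, μ and σ locally finite Radon measures on Ω with σ ≠ 0, and G a quasi-metric kernel on Ω. Then a nontrivial solution (equivalently, a nontrivial super-solution) of u = G(u^q dσ) + Gμ, 0 < u < +∞ σ-a.e., exists if and only if the following three conditions hold for some (equivalently, all) x₀ ∈ Ω and a > 0: ∫_a^∞ σ(B(x₀,r)) r^{−2} dr < ∞, ∫_a^∞ [ϰ(B(x₀,r))]^{q/(1−q)} r^{−2} dr < ∞, and ∫_a^∞ μ(B(x₀,r)) r^{−2} dr < ∞. -/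
open MeasureTheory ENNReal Set

noncomputable section

namespace NPE

variable {Ω : Type*} [TopologicalSpace Ω] [MeasurableSpace Ω]

set_option linter.unusedSectionVars false

lemma aux_inv (b : ℝ) (hb : 0 < b) :
    ∫⁻ r in Ioi b, (ENNReal.ofReal (r ^ 2))⁻¹ = (ENNReal.ofReal b)⁻¹ := by
  have h1 := integrableOn_Ioi_rpow_of_lt (a := -2) (by norm_num) hb
  have h2 := integral_Ioi_rpow_of_lt (a := -2) (by norm_num) hb
  have h3 := ofReal_integral_eq_lintegral_ofReal h1 (by
    filter_upwards [ae_restrict_mem measurableSet_Ioi] with x hx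
    exact Real.rpow_nonneg (hb.trans hx).le _)
  have h4 : ∫⁻ r in Ioi b, (ENNReal.ofReal (r ^ 2))⁻¹ = ∫⁻ r in Ioi b, ENNReal.ofReal (r ^ (-2:ℝ)) := by
    apply setLIntegral_congr_fun measurableSet_Ioi
    intro x hx
    have hx0 : 0 < x := hb.trans hx
    simp only
    rw [← ENNReal.ofReal_inv_of_pos (by positivity), Real.rpow_neg hx0.le]
    norm_cast
  rw [h4, ← h3, h2, ← ENNReal.ofReal_inv_of_pos hb]
  congr 1
  norm_num
  rw [Real.rpow_neg_one]

lemma ball_meas {G : Ω → Ω → ℝ≥0∞} (hm : ∀ x, Measurable (G x)) (x : Ω) (r : ℝ) :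
    MeasurableSet (ball G x r) :=
  measurableSet_lt (hm x).inv measurable_const

lemma layer {G : Ω → Ω → ℝ≥0∞} (hm : ∀ x, Measurable (G x)) (hp : ∀ x y, 0 < G x y)
    (lam : Measure Ω) [SFinite lam] (x : Ω) (a C : ℝ) (ha : 0 < a) (hC : 0 < C) :
    ∫⁻ r in Ioi a, lam (ball G x (C * r)) / ENNReal.ofReal (r ^ 2) =
      ∫⁻ z, (max (ENNReal.ofReal a) ((G x z)⁻¹ / ENNReal.ofReal C))⁻¹ ∂lam := by
  have hd : ∀ z, (G x z)⁻¹ ≠ ∞ := fun z => ENNReal.inv_ne_top.2 (hp x z).ne'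
  have e1 : ∀ r : ℝ, lam (ball G x (C * r)) / ENNReal.ofReal (r ^ 2) =
      ∫⁻ z, (({p : ℝ × Ω | (G x p.2)⁻¹ < ENNReal.ofReal (C * p.1)}).indicator
        (fun p => (ENNReal.ofReal (p.1 ^ 2))⁻¹) (r, z)) ∂lam := by
    intro r
    have : (fun z => (({p : ℝ × Ω | (G x p.2)⁻¹ < ENNReal.ofReal (C * p.1)}).indicator
        (fun p => (ENNReal.ofReal (p.1 ^ 2))⁻¹) (r, z))) =
        (ball G x (C * r)).indicator (fun _ => (ENNReal.ofReal (r ^ 2))⁻¹) := by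
      ext z
      by_cases hz : (G x z)⁻¹ < ENNReal.ofReal (C * r)
      · rw [indicator_of_mem (show (r, z) ∈ {p : ℝ × Ω | (G x p.2)⁻¹ < ENNReal.ofReal (C * p.1)} from hz),
          indicator_of_mem (show z ∈ ball G x (C * r) from hz)]
      · rw [indicator_of_notMem (show (r, z) ∉ {p : ℝ × Ω | (G x p.2)⁻¹ < ENNReal.ofReal (C * p.1)} from hz),
          indicator_of_notMem (show z ∉ ball G x (C * r) from hz)]
    rw [this, lintegral_indicator_const (ball_meas hm x _), div_eq_mul_inv]
    exact mul_comm _ _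
  simp_rw [e1]
  rw [lintegral_lintegral_swap]
  · apply lintegral_congr
    intro z
    have : ∀ r : ℝ, (({p : ℝ × Ω | (G x p.2)⁻¹ < ENNReal.ofReal (C * p.1)}).indicator
        (fun p => (ENNReal.ofReal (p.1 ^ 2))⁻¹) (r, z)) =
        (Ioi ((G x z)⁻¹.toReal / C)).indicator (fun r => (ENNReal.ofReal (r ^ 2))⁻¹) r := by
      intro r
      have : (G x z)⁻¹ < ENNReal.ofReal (C * r) ↔ (G x z)⁻¹.toReal / C < r := by
        rw [ENNReal.lt_ofReal_iff_toReal_lt (hd z), div_lt_iff₀ hC, mul_comm]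
      simp [indicator, this]
    simp_rw [this]
    rw [setLIntegral_indicator measurableSet_Ioi, Ioi_inter_Ioi, aux_inv _ (lt_sup_of_lt_right ha)]
    congr 1
    rw [sup_comm, ENNReal.ofReal_max, ENNReal.ofReal_div_of_pos hC, ENNReal.ofReal_toReal (hd z)]
  · apply Measurable.aemeasurable
    apply Measurable.indicator
    · fun_prop
    · apply measurableSet_lt
      · exact ((hm x).comp measurable_snd).inv
      · fun_prop

lemma layer1 {G : Ω → Ω → ℝ≥0∞} (hm : ∀ x, Measurable (G x)) (hp : ∀ x y, 0 < G x y)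
    (lam : Measure Ω) [SFinite lam] (x : Ω) (a : ℝ) (ha : 0 < a) :
    ∫⁻ r in Ioi a, lam (ball G x r) / ENNReal.ofReal (r ^ 2) =
      ∫⁻ z, (max (ENNReal.ofReal a) ((G x z)⁻¹))⁻¹ ∂lam := by
  simpa using layer hm hp lam x a 1 ha one_pos

/-- Kolmogorov inequality -/
lemma kolm (q : ℝ) (hq0 : 0 < q) (hq1 : q < 1) : ∃ D : ℝ≥0∞, D ≠ 0 ∧ D ≠ ∞ ∧
    ∀ (m : Measure Ω) (f : Ω → ℝ≥0∞) (A : ℝ≥0∞), Measurable f → m univ ≠ ∞ → A ≠ 0 → A ≠ ∞ →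
    (∀ t : ℝ≥0∞, t ≠ 0 → t ≠ ∞ → t * m {x | t < f x} ≤ A) →
    ∫⁻ x, f x ^ q ∂m ≤ D * A ^ q * (m univ) ^ (1 - q) := by
  set θ : ℝ≥0∞ := (2:ℝ≥0∞) ^ (q - 1) with hθ
  have hθ1 : θ < 1 := ENNReal.rpow_lt_one_of_one_lt_of_neg (by norm_num) (by linarith)
  refine ⟨1 + 2 ^ q * ∑' k : ℕ, θ ^ k, by simp, ?_, ?_⟩
  · rw [ENNReal.tsum_geometric]
    refine ENNReal.add_ne_top.2 ⟨by simp, ENNReal.mul_ne_top (by simp) ?_⟩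
    rw [ENNReal.inv_ne_top]
    exact (tsub_pos_of_lt hθ1).ne'
  intro m f A hf hT hA0 hA h
  by_cases hT0 : m univ = 0
  · rw [Measure.measure_univ_eq_zero.1 hT0]; simp
  set T := m univ with hTdef
  set s := A / T with hs
  have hs0 : s ≠ 0 := by simp [hs, ENNReal.div_eq_zero_iff, hA0, hT]
  have hs1 : s ≠ ∞ := ENNReal.div_ne_top hA hT0
  have pw : ∀ x, f x ^ q ≤ s ^ q + ∑' k : ℕ,
      ({x | 2 ^ k * s < f x} : Set Ω).indicator (fun _ => (2 ^ (k+1) * s) ^ q) x := by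
    intro x
    by_cases h1 : f x ≤ s
    · exact le_add_right (ENNReal.rpow_le_rpow h1 hq0.le)
    push Not at h1
    apply le_add_left
    by_cases h2 : f x = ∞
    · have : ∑' k : ℕ, ({x | 2 ^ k * s < f x} : Set Ω).indicator
          (fun _ => (2 ^ (k+1) * s) ^ q) x = ∞ := by
        rw [eq_top_iff, ← ENNReal.tsum_const_eq_top_of_ne_zero (α := ℕ) (c := s ^ q) (by simp [hs0, hs1])]
        apply ENNReal.tsum_le_tsum
        intro k
        rw [indicator_of_mem]
        · apply ENNReal.rpow_le_rpow _ hq0.le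
          exact le_mul_of_one_le_left (zero_le) (one_le_pow₀ (by norm_num))
        · show _ < f x
          rw [h2]; exact ENNReal.mul_lt_top (by simp) hs1.lt_top
      rw [this]; exact le_top
    · have hex : ∃ n : ℕ, f x ≤ 2 ^ n * s := by
        have : f x / s ≠ ∞ := ENNReal.div_ne_top h2 hs0
        obtain ⟨n, hn⟩ := ENNReal.exists_nat_gt this
        refine ⟨n, ?_⟩
        rw [← ENNReal.div_le_iff hs0 hs1]
        refine hn.le.trans ?_
        exact_mod_cast Nat.lt_two_pow_self.le
      classical
      have hn := Nat.find_spec hex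
      obtain ⟨k, hk⟩ : ∃ k, Nat.find hex = k + 1 := by
        apply Nat.exists_eq_succ_of_ne_zero
        intro h0
        rw [h0] at hn
        simp at hn
        exact absurd hn (not_le.2 h1)
      have hk2 : ¬ (f x ≤ 2 ^ k * s) := Nat.find_min hex (by omega)
      rw [hk] at hn
      refine le_trans ?_ (ENNReal.le_tsum k)
      rw [indicator_of_mem (show x ∈ {x | 2 ^ k * s < f x} from not_le.1 hk2)]
      exact ENNReal.rpow_le_rpow hn hq0.le
  have hms : ∀ k : ℕ, MeasurableSet {x | 2 ^ k * s < f x} := fun k => measurableSet_lt measurable_const hf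
  have hb : ∫⁻ x, f x ^ q ∂m ≤ s ^ q * T + ∑' k : ℕ, (2 ^ (k+1) * s) ^ q * m {x | 2 ^ k * s < f x} := by
    refine (lintegral_mono pw).trans ?_
    rw [lintegral_add_left measurable_const, lintegral_const, lintegral_tsum]
    · gcongr with k
      rw [lintegral_indicator_const (hms k)]
    · intro k; exact (measurable_const.indicator (hms k)).aemeasurable
  have hsT : s * T = A := ENNReal.div_mul_cancel hT0 hT
  have hsq : s ^ q * T = A ^ q * T ^ (1 - q) := by
    rw [hs, ENNReal.div_rpow_of_nonneg _ _ hq0.le, ENNReal.rpow_sub _ _ hT0 hT, ENNReal.rpow_one,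
      div_eq_mul_inv, div_eq_mul_inv]
    ring
  have hk : ∀ k : ℕ, (2 ^ (k+1) * s) ^ q * m {x | 2 ^ k * s < f x} ≤ (s ^ q * T) * 2 ^ q * θ ^ k := by
    intro k
    have h2k : (2:ℝ≥0∞) ^ k ≠ 0 := by simp
    have h2k' : (2:ℝ≥0∞) ^ k ≠ ∞ := by simp
    have := h (2 ^ k * s) (mul_ne_zero h2k hs0) (ENNReal.mul_ne_top h2k' hs1)
    have h5 : m {x | 2 ^ k * s < f x} ≤ T / 2 ^ k := by
      rw [ENNReal.le_div_iff_mul_le (Or.inl h2k) (Or.inl h2k')]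
      rw [← hsT, mul_right_comm, mul_comm _ s] at this
      rw [mul_comm]
      exact (ENNReal.mul_le_mul_iff_right hs0 hs1).1 this
    calc _ ≤ (2 ^ (k+1) * s) ^ q * (T / 2 ^ k) := by gcongr
      _ = _ := by
        rw [ENNReal.mul_rpow_of_nonneg _ _ hq0.le, pow_succ, ENNReal.mul_rpow_of_nonneg _ _ hq0.le]
        have : θ ^ k = ((2:ℝ≥0∞) ^ k) ^ q / 2 ^ k := by
          rw [hθ, ← ENNReal.rpow_natCast, ← ENNReal.rpow_mul, ← ENNReal.rpow_natCast, ← ENNReal.rpow_mul,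
            ← ENNReal.rpow_sub _ _ (by norm_num) (by norm_num)]
          congr 1; ring
        rw [this, div_eq_mul_inv, div_eq_mul_inv]; ring
  calc _ ≤ _ := hb
    _ ≤ s ^ q * T + ∑' k : ℕ, (s ^ q * T) * 2 ^ q * θ ^ k := by exact add_le_add le_rfl (ENNReal.tsum_le_tsum hk)
    _ = _ := by rw [ENNReal.tsum_mul_left, mul_assoc _ (A ^ q), ← hsq]; ring

structure QK (G : Ω → Ω → ℝ≥0∞) (κ : ℝ) : Prop where
  hk : (1 / 2 : ℝ) ≤ κ
  mj : Measurable (fun p : Ω × Ω => G p.1 p.2)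
  op : ∀ x r, IsOpen (ball G x r)
  pos : ∀ x y, 0 < G x y
  symm : ∀ x y, G x y = G y x
  tri : ∀ x y z, (G x y)⁻¹ ≤ ENNReal.ofReal κ * ((G x z)⁻¹ + (G z y)⁻¹)

lemma QK.m {G : Ω → Ω → ℝ≥0∞} {κ : ℝ} (h : QK G κ) (x : Ω) : Measurable (G x) :=
  h.mj.comp measurable_prodMk_left

lemma QK.of [SecondCountableTopology Ω] [BorelSpace Ω] {G : Ω → Ω → ℝ≥0∞} {κ : ℝ}
    (h : IsQuasiMetricKernel G κ) : QK G κ := by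
  obtain ⟨h1, h2, h3, h4, h5⟩ := h
  refine ⟨h2, h1.measurable, ?_, h3, h4, h5⟩
  intro x r
  have : ball G x r = (fun y => (x, y)) ⁻¹' ((fun p : Ω × Ω => G p.1 p.2) ⁻¹' Ioi (ENNReal.ofReal r)⁻¹) := by
    ext y
    simp only [ball, mem_ofPred_eq, mem_preimage, mem_Ioi]
    rw [ENNReal.inv_lt_iff_inv_lt]
  rw [this]
  exact (h1.isOpen_preimage _).preimage (by fun_prop)

lemma pot_meas {G : Ω → Ω → ℝ≥0∞} {κ : ℝ} (h : QK G κ) (ν : Measure Ω) [SFinite ν] :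
    Measurable (pot G ν) :=
  h.mj.lintegral_prod_right'

/-- local weak type step -/
lemma pot_le_of_ball {G : Ω → Ω → ℝ≥0∞} {κ : ℝ} (h : QK G κ) (ν ω : Measure Ω) [SFinite ν]
    [SFinite ω] (x : Ω) (c : ℝ) (hc : 0 < c) (t : ℝ≥0∞) (ht : t ≠ ∞)
    (hb : ∀ r : ℝ, 0 < r → ν (ball G x r) ≤ t * ω (ball G x (c * r))) :
    pot G ν x ≤ t * ENNReal.ofReal c * pot G ω x := by
  have key : ∀ a : ℝ, 0 < a → ∫⁻ z, (max (ENNReal.ofReal a) ((G x z)⁻¹))⁻¹ ∂ν ≤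
      t * ENNReal.ofReal c * pot G ω x := by
    intro a ha
    rw [← layer1 h.m h.pos ν x a ha]
    calc _ ≤ ∫⁻ r in Ioi a, t * (ω (ball G x (c * r)) / ENNReal.ofReal (r ^ 2)) := by
          apply setLIntegral_mono' measurableSet_Ioi
          intro r hr
          rw [← mul_div_assoc]
          exact ENNReal.div_le_div_right (hb r (ha.trans hr)) _
      _ = t * ∫⁻ z, (max (ENNReal.ofReal a) ((G x z)⁻¹ / ENNReal.ofReal c))⁻¹ ∂ω := by
          rw [lintegral_const_mul' _ _ ht, layer h.m h.pos ω x a c ha hc]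
      _ ≤ t * ∫⁻ z, ENNReal.ofReal c * G x z ∂ω := by
          gcongr with z
          refine (ENNReal.inv_le_inv.2 (le_max_right _ _)).trans ?_
          rw [ENNReal.inv_div (by simp) (by simp [hc]), div_eq_mul_inv, inv_inv]
      _ = _ := by
          rw [lintegral_const_mul' _ _ (by simp), mul_assoc]; rfl
  have hlim : Filter.Tendsto (fun n : ℕ => ∫⁻ z, (max (ENNReal.ofReal (1 / ((n:ℝ) + 1))) ((G x z)⁻¹))⁻¹ ∂ν)
      Filter.atTop (nhds (pot G ν x)) := by
    apply lintegral_tendsto_of_tendsto_of_monotone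
    · intro n
      exact ((measurable_const.max (h.m x).inv).inv).aemeasurable
    · filter_upwards with z
      intro n k hnk
      apply ENNReal.inv_le_inv.2
      apply max_le_max _ le_rfl
      apply ENNReal.ofReal_le_ofReal
      exact one_div_le_one_div_of_le (by positivity) (by exact_mod_cast Nat.succ_le_succ hnk)
    · filter_upwards with z
      have h1 : Filter.Tendsto (fun n : ℕ => ENNReal.ofReal (1 / ((n:ℝ) + 1))) Filter.atTop (nhds 0) := by
        simpa using ENNReal.tendsto_ofReal tendsto_one_div_add_atTop_nhds_zero_nat
      have h2 := (h1.max (tendsto_const_nhds (x := (G x z)⁻¹))).inv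
      simpa using h2
  exact le_of_tendsto' hlim (fun n => key _ (by positivity))

lemma weak_type [SecondCountableTopology Ω] {G : Ω → Ω → ℝ≥0∞} {κ : ℝ} (h : QK G κ)
    (ν ω : Measure Ω) [SFinite ν] [SFinite ω] [OpensMeasurableSpace Ω] (t : ℝ≥0∞) (ht : t ≠ ∞) :
    t * ω {x | t * ENNReal.ofReal (3 * κ) * pot G ω x < pot G ν x} ≤ ν univ := by
  have hκ : 0 < κ := lt_of_lt_of_le (by norm_num) h.hk
  set E : ℕ → Set Ω := fun N => {x | ∃ r : ℝ, 0 < r ∧ r ≤ N ∧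
    t * ω (ball G x (3 * κ * r)) < ν (ball G x r)} with hE
  have hsub : {x | t * ENNReal.ofReal (3 * κ) * pot G ω x < pot G ν x} ⊆ ⋃ N, E N := by
    intro x hx
    by_contra hcon
    simp only [hE, mem_iUnion, mem_ofPred_eq, not_exists, not_and, not_lt] at hcon
    have hx' : t * ENNReal.ofReal (3 * κ) * pot G ω x < pot G ν x := hx
    refine absurd hx' (not_lt.2 ?_)
    apply pot_le_of_ball h ν ω x _ (by positivity) t ht
    intro r hr
    obtain ⟨N, hN⟩ := exists_nat_ge r
    exact hcon N r hr hN
  have hmono : Monotone E := by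
    intro N M hNM x ⟨r, h1, h2, h3⟩
    exact ⟨r, h1, h2.trans (by exact_mod_cast hNM), h3⟩
  have hN : ∀ N, t * ω (E N) ≤ ν univ := by
    intro N
    choose! r hr0 hrN hr using (fun x (hx : x ∈ E N) => hx)
    have hne : ∀ x ∈ E N, (ball G x (r x)).Nonempty := by
      intro x hx
      apply nonempty_of_measure_ne_zero (μ := ν)
      exact (lt_of_le_of_lt zero_le (hr x hx)).ne'
    obtain ⟨v, hvE, hdis, hcov⟩ := Vitali.exists_disjoint_subfamily_covering_enlargement
      (fun x => ball G x (r x)) (E N) r 2 (by norm_num) (fun x hx => (hr0 x hx).le) N hrN hne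
    have hcnt : v.Countable := hdis.countable_of_isOpen (fun x _ => h.op _ _) (fun x hx => hne x (hvE hx))
    have hEs : E N ⊆ ⋃ b ∈ v, ball G b (3 * κ * r b) := by
      intro x hx
      obtain ⟨b, hb, ⟨z, hz1, hz2⟩, hle⟩ := hcov x hx
      simp only [mem_iUnion]
      refine ⟨b, hb, ?_⟩
      have hb0 := hr0 b (hvE hb)
      have hx0 := hr0 x hx
      have hz1' : (G x z)⁻¹ < ENNReal.ofReal (r x) := hz1
      have hz2' : (G b z)⁻¹ < ENNReal.ofReal (r b) := hz2
      show (G b x)⁻¹ < _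
      calc (G b x)⁻¹ ≤ ENNReal.ofReal κ * ((G b z)⁻¹ + (G z x)⁻¹) := h.tri _ _ _
        _ < ENNReal.ofReal κ * (ENNReal.ofReal (r b) + ENNReal.ofReal (r x)) := by
          rw [h.symm z x]
          exact (ENNReal.mul_lt_mul_iff_right (by simpa using hκ) (by simp)).2 (ENNReal.add_lt_add hz2' hz1')
        _ ≤ ENNReal.ofReal (3 * κ * r b) := by
          rw [← ENNReal.ofReal_add hb0.le hx0.le, ← ENNReal.ofReal_mul hκ.le]
          apply ENNReal.ofReal_le_ofReal
          nlinarith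
    have := hcnt.to_subtype
    calc t * ω (E N) ≤ t * ∑' b : v, ω (ball G b (3 * κ * r b)) := by
          gcongr
          refine (measure_mono hEs).trans ?_
          rw [biUnion_eq_iUnion]
          exact measure_iUnion_le _
      _ = ∑' b : v, t * ω (ball G b (3 * κ * r b)) := by rw [ENNReal.tsum_mul_left]
      _ ≤ ∑' b : v, ν (ball G b (r b)) := ENNReal.tsum_le_tsum (fun b => (hr b (hvE b.2)).le)
      _ = ν (⋃ b ∈ v, ball G b (r b)) := by
          rw [measure_biUnion hcnt hdis (fun b _ => (h.op _ _).measurableSet)]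
      _ ≤ ν univ := measure_mono (subset_univ _)
  calc _ ≤ t * ω (⋃ N, E N) := by gcongr
    _ = ⨆ N, t * ω (E N) := by rw [hmono.measure_iUnion, ENNReal.mul_iSup]
    _ ≤ _ := iSup_le hN

lemma small_tail (m : Measure Ω) (ρ : Ω → ℝ≥0∞) (lam : ℝ≥0∞) :
    m {y | m {z | ρ y ≤ ρ z} ≤ lam} ≤ lam := by
  set S := {y | m {z | ρ y ≤ ρ z} ≤ lam} with hS
  rcases S.eq_empty_or_nonempty with h0 | hne
  · rw [h0]; simp
  have hne' : (ρ '' S).Nonempty := hne.image _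
  by_cases hin : sInf (ρ '' S) ∈ ρ '' S
  · obtain ⟨y, hy, hy2⟩ := hin
    refine le_trans (measure_mono ?_) hy
    intro z hz
    show ρ y ≤ ρ z
    rw [hy2]; exact sInf_le (mem_image_of_mem _ hz)
  obtain ⟨t, ht, htl, htm⟩ := exists_seq_tendsto_sInf hne' (OrderBot.bddBelow _)
  have hsub : S ⊆ ⋃ n, {z | t n ≤ ρ z} := by
    intro z hz
    have h1 : sInf (ρ '' S) < ρ z := lt_of_le_of_ne (sInf_le (mem_image_of_mem _ hz))
      (fun e => hin (e ▸ mem_image_of_mem _ hz))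
    obtain ⟨n, hn⟩ := (htl.eventually (gt_mem_nhds h1)).exists
    exact mem_iUnion.2 ⟨n, hn.le⟩
  have hm : Monotone (fun n => {z | t n ≤ ρ z}) := by
    intro n k hnk z hz
    exact (ht hnk).trans hz
  refine (measure_mono hsub).trans ?_
  rw [hm.measure_iUnion]
  apply iSup_le
  intro n
  obtain ⟨y, hy, hy2⟩ := htm n
  rw [← hy2]; exact hy

lemma inv_aux {a b c : ℝ≥0∞} (hc0 : c ≠ 0) (hc : c ≠ ∞) (h : a⁻¹ ≤ c * b⁻¹) : b ≤ c * a := by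
  have h1 : c * b⁻¹ = (c⁻¹ * b)⁻¹ := by
    rw [ENNReal.mul_inv (Or.inl (by simpa using hc)) (Or.inl (by simpa using hc0)), inv_inv]
  rw [h1, ENNReal.inv_le_inv] at h
  calc b = c * (c⁻¹ * b) := by rw [← mul_assoc, ENNReal.mul_inv_cancel hc0 hc, one_mul]
    _ ≤ c * a := by gcongr

lemma lower_bound (κ q : ℝ) (hq0 : 0 < q) (hq1 : q < 1) : ∃ C : ℝ≥0∞, C ≠ 0 ∧ C ≠ ∞ ∧
    ∀ (G : Ω → Ω → ℝ≥0∞) (_ : QK G κ) (σ : Measure Ω) [SFinite σ] (u : Ω → ℝ≥0∞) (_ : Measurable u)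
    (_ : ∀ᵐ x ∂σ, 0 < u x) (_ : ∀ᵐ x ∂σ, potF G σ (fun y => u y ^ q) x ≤ u x ∧ u x < ∞) (x : Ω),
    pot G σ x ≤ C * (potF G σ (fun y => u y ^ q) x) ^ (1 - q) := by
  obtain ⟨D, hD0, hD, hkol⟩ := kolm (Ω := Ω) q hq0 hq1
  by_cases hκ' : 0 < κ
  swap
  · refine ⟨1, by simp, by simp, ?_⟩
    intro G h
    exact absurd (lt_of_lt_of_le (by norm_num) h.hk) hκ'
  set c : ℝ≥0∞ := 2 * ENNReal.ofReal κ with hc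
  have hc0 : c ≠ 0 := by simp [hc, hκ']
  have hct : c ≠ ∞ := by rw [hc]; exact ENNReal.mul_ne_top (by simp) (by simp)
  have hcq0 : c ^ q ≠ 0 := by simp [ENNReal.rpow_eq_zero_iff, hc0, hct]
  have hcqt : c ^ q ≠ ∞ := ENNReal.rpow_ne_top_of_nonneg hq0.le hct
  refine ⟨c ^ q * D, mul_ne_zero hcq0 hD0, ENNReal.mul_ne_top hcqt hD, ?_⟩
  intro G h σ _ u hu hpos hsup x
  set ω : Ω → ℝ≥0∞ := fun y => G x y * u y ^ q with hω
  have hωm : Measurable ω := (h.m x).mul (hu.pow_const q)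
  set m := σ.withDensity ω with hm
  have hT : m univ = potF G σ (fun y => u y ^ q) x := by
    rw [hm, withDensity_apply _ MeasurableSet.univ, Measure.restrict_univ]; rfl
  rw [← hT]
  by_cases hTt : m univ = ∞
  · rw [hTt, ENNReal.top_rpow_of_pos (by linarith), ENNReal.mul_top (mul_ne_zero hcq0 hD0)]
    exact le_top
  set ρ : Ω → ℝ≥0∞ := fun z => (G x z)⁻¹ with hρ
  have hρm : Measurable ρ := (h.m x).inv
  set F : Ω → ℝ≥0∞ := fun y => m {z | ρ y ≤ ρ z} with hF
  have hFm : Measurable F := by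
    have : Antitone (fun t : ℝ≥0∞ => m {z | t ≤ ρ z}) := fun s t hst =>
      measure_mono (fun z hz => hst.trans hz)
    exact this.measurable.comp hρm
  have hFu : ∀ y, F y ≤ c * potF G σ (fun y => u y ^ q) y := by
    intro y
    have hS : MeasurableSet {z | ρ y ≤ ρ z} := measurableSet_le measurable_const hρm
    simp only [hF, hm]
    rw [withDensity_apply _ hS]
    unfold potF
    rw [← lintegral_const_mul' _ _ hct]
    refine le_trans ?_ (setLIntegral_le_lintegral {z | ρ y ≤ ρ z} _)
    apply setLIntegral_mono' hS
    intro z hz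
    simp only [hω]
    rw [← mul_assoc]
    refine mul_le_mul_left ?_ (u z ^ q)
    apply inv_aux hc0 hct
    calc (G y z)⁻¹ ≤ ENNReal.ofReal κ * ((G y x)⁻¹ + (G x z)⁻¹) := h.tri _ _ _
      _ ≤ ENNReal.ofReal κ * ((G x z)⁻¹ + (G x z)⁻¹) := by
        gcongr
        rw [h.symm y x]; exact ENNReal.inv_le_inv.1 hz
      _ = c * (G x z)⁻¹ := by rw [hc]; ring
  have hK := hkol m (fun y => (F y)⁻¹) 1 hFm.inv hTt (by simp) (by simp) (by
    intro t ht0 ht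
    have : {y | t < (F y)⁻¹} ⊆ {y | m {z | ρ y ≤ ρ z} ≤ t⁻¹} := by
      intro y hy
      have hy' : t < (F y)⁻¹ := hy
      rw [ENNReal.lt_inv_iff_lt_inv] at hy'
      exact hy'.le
    calc _ ≤ t * t⁻¹ := by
          gcongr
          exact (measure_mono this).trans (small_tail m ρ t⁻¹)
      _ = 1 := ENNReal.mul_inv_cancel ht0 ht)
  calc pot G σ x = ∫⁻ y, ω y * (u y ^ q)⁻¹ ∂σ := by
        apply lintegral_congr_ae
        filter_upwards [hpos, hsup] with y h1 h2
        rw [hω, mul_assoc, ENNReal.mul_inv_cancel, mul_one]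
        · simp [ENNReal.rpow_eq_zero_iff, h1.ne', h2.2.ne]
        · exact ENNReal.rpow_ne_top_of_nonneg hq0.le h2.2.ne
    _ ≤ ∫⁻ y, ω y * (c ^ q * (F y)⁻¹ ^ q) ∂σ := by
        apply lintegral_mono_ae
        filter_upwards [hsup] with y h2
        gcongr
        rw [← ENNReal.mul_rpow_of_nonneg _ _ hq0.le, ← ENNReal.inv_rpow]
        gcongr
        rw [ENNReal.inv_le_iff_inv_le, ENNReal.mul_inv (Or.inl hc0) (Or.inl hct), inv_inv, mul_comm,
          ← div_eq_mul_inv]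
        apply ENNReal.div_le_of_le_mul
        rw [mul_comm]
        exact (hFu y).trans (by gcongr; exact h2.1)
    _ = c ^ q * ∫⁻ y, (F y)⁻¹ ^ q ∂m := by
        have hF2 : Measurable (fun y => (F y)⁻¹ ^ q) := hFm.inv.pow_const q
        rw [hm, lintegral_withDensity_eq_lintegral_mul _ hωm hF2,
          ← lintegral_const_mul' _ _ hcqt]
        apply lintegral_congr
        intro y
        simp only [Pi.mul_apply]
        ring
    _ ≤ c ^ q * (D * 1 ^ q * (m univ) ^ (1 - q)) := by gcongr
    _ = _ := by rw [ENNReal.one_rpow]; ring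

lemma kappa_spec (G : Ω → Ω → ℝ≥0∞) (q : ℝ) (hq0 : 0 < q) (σ ν : Measure Ω) [hν : IsFiniteMeasure ν] :
    ∫⁻ x, pot G ν x ^ q ∂σ ≤ (kappa G q σ * ν univ) ^ q := by
  have h1 : lqNorm q σ (pot G ν) ≤ kappa G q σ * ν univ := by
    by_cases h0 : ν univ = 0
    · rw [Measure.measure_univ_eq_zero.1 h0]
      simp [lqNorm, pot, hq0]
    · rw [← ENNReal.div_le_iff h0 (measure_ne_top _ _)]
      apply le_sInf
      intro C hC
      rw [ENNReal.div_le_iff h0 (measure_ne_top _ _)]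
      exact hC ν hν
  have := ENNReal.rpow_le_rpow h1 hq0.le
  rwa [lqNorm, ← ENNReal.rpow_mul, one_div, inv_mul_cancel₀ hq0.ne', ENNReal.rpow_one] at this

lemma kappa_mono (G : Ω → Ω → ℝ≥0∞) (q : ℝ) (hq0 : 0 < q) {σ τ : Measure Ω} (h : σ ≤ τ) :
    kappa G q σ ≤ kappa G q τ := by
  apply sInf_le_sInf
  intro C hC ν hν
  refine le_trans ?_ (hC ν hν)
  unfold lqNorm
  gcongr

lemma kappa_upper [SecondCountableTopology Ω] [OpensMeasurableSpace Ω]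
    (κ q : ℝ) (hq0 : 0 < q) (hq1 : q < 1) : ∃ C : ℝ≥0∞, C ≠ ∞ ∧
    ∀ (G : Ω → Ω → ℝ≥0∞) (_ : QK G κ) (σ : Measure Ω) [SFinite σ] (u : Ω → ℝ≥0∞) (_ : Measurable u)
    (_ : ∀ᵐ x ∂σ, 0 < u x) (_ : ∀ᵐ x ∂σ, potF G σ (fun y => u y ^ q) x ≤ u x ∧ u x < ∞) (B : Set Ω),
    MeasurableSet B → σ.withDensity (fun y => u y ^ q) B ≠ ∞ →
    kappa G q (σ.restrict B) ^ (q / (1 - q)) ≤ C * σ.withDensity (fun y => u y ^ q) B := by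
  obtain ⟨D, hD0, hD, hkol⟩ := kolm (Ω := Ω) q hq0 hq1
  by_cases hκ' : 0 < κ
  swap
  · refine ⟨1, by simp, ?_⟩
    intro G h
    exact absurd (lt_of_lt_of_le (by norm_num) h.hk) hκ'
  set c := ENNReal.ofReal (3 * κ) with hc
  have hc0 : c ≠ 0 := by simp [hc, hκ']
  have hct : c ≠ ∞ := ENNReal.ofReal_ne_top
  have h1q : 0 < 1 - q := by linarith
  have hqq : 0 ≤ q / (1 - q) := by positivity
  refine ⟨((D * c ^ q) ^ (1 / q)) ^ (q / (1 - q)), ?_, ?_⟩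
  · apply ENNReal.rpow_ne_top_of_nonneg hqq
    apply ENNReal.rpow_ne_top_of_nonneg (by positivity)
    exact ENNReal.mul_ne_top hD (ENNReal.rpow_ne_top_of_nonneg hq0.le hct)
  intro G h σ _ u hu hpos hsup B hB hfin
  set T := σ.withDensity (fun y => u y ^ q) B with hT
  set ω := (σ.restrict B).withDensity (fun y => u y ^ q) with hω
  have hum : Measurable (fun y => u y ^ q) := hu.pow_const q
  have hωT : ω univ = T := by
    rw [hω, withDensity_apply _ MeasurableSet.univ, Measure.restrict_univ, hT, withDensity_apply _ hB]
  have hωpot : ∀ x, pot G ω x ≤ potF G σ (fun y => u y ^ q) x := by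
    intro x
    unfold pot potF
    rw [hω, lintegral_withDensity_eq_lintegral_mul _ hum (h.m x)]
    refine (setLIntegral_le_lintegral _ _).trans (le_of_eq ?_)
    apply lintegral_congr
    intro y
    simp only [Pi.mul_apply]
    ring
  have hk : kappa G q (σ.restrict B) ≤ (D * c ^ q) ^ (1 / q) * T ^ ((1 - q) / q) := by
    apply sInf_le
    intro ν hν
    by_cases hν0 : ν univ = 0
    · rw [Measure.measure_univ_eq_zero.1 hν0]
      simp [lqNorm, pot, hq0]
    have hpm := pot_meas h ν
    have hK := hkol ω (fun x => pot G ν x / u x) (c * ν univ) (hpm.div hu) (by rwa [hωT])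
      (mul_ne_zero hc0 hν0) (ENNReal.mul_ne_top hct (measure_ne_top _ _)) (by
        intro t ht0 ht
        have hw := weak_type h ν ω (t / c) (ENNReal.div_ne_top ht hc0)
        rw [← hc, ENNReal.div_mul_cancel hc0 hct] at hw
        have hae : ω {x | t < pot G ν x / u x} ≤ ω {x | t * pot G ω x < pot G ν x} := by
          apply measure_mono_ae
          have hac : ω ≪ σ := (withDensity_absolutelyContinuous _ _).trans Measure.absolutelyContinuous_restrict
          filter_upwards [hac.ae_le hpos, hac.ae_le hsup] with x h1 h2 h3
          have h3' : t < pot G ν x / u x := h3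
          rw [ENNReal.lt_div_iff_mul_lt (Or.inl h1.ne') (Or.inl h2.2.ne)] at h3'
          refine lt_of_le_of_lt ?_ h3'
          exact mul_le_mul_right ((hωpot x).trans h2.1) t
        calc _ ≤ t * ω {x | t * pot G ω x < pot G ν x} := by gcongr
          _ = c * (t / c * ω {x | t * pot G ω x < pot G ν x}) := by
            rw [← mul_assoc, ENNReal.mul_div_cancel hc0 hct]
          _ ≤ _ := by gcongr)
    have hI : ∫⁻ x, pot G ν x ^ q ∂(σ.restrict B) = ∫⁻ x, (pot G ν x / u x) ^ q ∂ω := by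
      have hF2 : Measurable (fun x => (pot G ν x / u x) ^ q) := (hpm.div hu).pow_const q
      rw [hω, lintegral_withDensity_eq_lintegral_mul _ hum hF2]
      apply lintegral_congr_ae
      filter_upwards [ae_restrict_of_ae hpos, ae_restrict_of_ae hsup] with x h1 h2
      simp only [Pi.mul_apply]
      rw [← ENNReal.mul_rpow_of_nonneg _ _ hq0.le, ENNReal.mul_div_cancel h1.ne' h2.2.ne]
    unfold lqNorm
    rw [hI]
    rw [hωT] at hK
    calc _ ≤ (D * (c * ν univ) ^ q * T ^ (1 - q)) ^ (1 / q) := by gcongr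
      _ = _ := by
        have hiq : 0 ≤ 1 / q := by positivity
        rw [ENNReal.mul_rpow_of_nonneg _ _ hq0.le, ← mul_assoc, ENNReal.mul_rpow_of_nonneg _ _ hiq,
          ENNReal.mul_rpow_of_nonneg _ _ hiq, ← ENNReal.rpow_mul (ν univ), ← ENNReal.rpow_mul T,
          mul_one_div_cancel hq0.ne', ENNReal.rpow_one, mul_one_div]
        ring
  calc _ ≤ ((D * c ^ q) ^ (1 / q) * T ^ ((1 - q) / q)) ^ (q / (1 - q)) := by gcongr
    _ = _ := by
      rw [ENNReal.mul_rpow_of_nonneg _ _ hqq, ← ENNReal.rpow_mul T]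
      have : (1 - q) / q * (q / (1 - q)) = 1 := by field_simp
      rw [this, ENNReal.rpow_one]

lemma max_cmp {G : Ω → Ω → ℝ≥0∞} {κ : ℝ} (h : QK G κ) (x₀ x₁ : Ω) (a : ℝ) (ha : 0 < a) :
    ∃ C : ℝ≥0∞, C ≠ ∞ ∧ ∀ z, (max (ENNReal.ofReal a) ((G x₀ z)⁻¹))⁻¹ ≤ C * G x₁ z := by
  have hκ : 0 < κ := lt_of_lt_of_le (by norm_num) h.hk
  set D := (G x₁ x₀)⁻¹ with hD
  have hDt : D ≠ ∞ := ENNReal.inv_ne_top.2 (h.pos _ _).ne'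
  set C := ENNReal.ofReal κ * (D / ENNReal.ofReal a + 1) with hC
  have ha0 : ENNReal.ofReal a ≠ 0 := by simpa using ha
  have hC0 : C ≠ 0 := mul_ne_zero (by simpa using hκ) (by simp)
  have hCt : C ≠ ∞ := ENNReal.mul_ne_top (by simp)
    (ENNReal.add_ne_top.2 ⟨ENNReal.div_ne_top hDt ha0, by simp⟩)
  refine ⟨C, hCt, fun z => ?_⟩
  apply inv_aux hC0 hCt
  rw [inv_inv]
  calc (G x₁ z)⁻¹ ≤ ENNReal.ofReal κ * (D + (G x₀ z)⁻¹) := h.tri _ _ _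
    _ ≤ ENNReal.ofReal κ * (D / ENNReal.ofReal a * max (ENNReal.ofReal a) ((G x₀ z)⁻¹) +
        1 * max (ENNReal.ofReal a) ((G x₀ z)⁻¹)) := by
      gcongr
      · calc D = D / ENNReal.ofReal a * ENNReal.ofReal a := (ENNReal.div_mul_cancel ha0 (by simp)).symm
          _ ≤ _ := by gcongr; exact le_max_left _ _
      · rw [one_mul]; exact le_max_right _ _
    _ = _ := by rw [hC]; ring

lemma J_fin {G : Ω → Ω → ℝ≥0∞} {κ : ℝ} (h : QK G κ) (lam : Measure Ω) [SFinite lam] (x₁ : Ω)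
    (hx : pot G lam x₁ < ∞) (x₀ : Ω) (a : ℝ) (ha : 0 < a) :
    ∫⁻ r in Ioi a, lam (ball G x₀ r) / ENNReal.ofReal (r ^ 2) < ∞ := by
  rw [layer1 h.m h.pos lam x₀ a ha]
  obtain ⟨C, hC, hle⟩ := max_cmp h x₀ x₁ a ha
  calc _ ≤ ∫⁻ z, C * G x₁ z ∂lam := lintegral_mono hle
    _ = C * pot G lam x₁ := lintegral_const_mul' _ _ hC
    _ < ∞ := ENNReal.mul_lt_top hC.lt_top hx

lemma ball_mono (G : Ω → Ω → ℝ≥0∞) (x : Ω) {r s : ℝ} (h : r ≤ s) : ball G x r ⊆ ball G x s :=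
  fun _ hy => lt_of_lt_of_le hy (ENNReal.ofReal_le_ofReal h)

lemma ball_fin {G : Ω → Ω → ℝ≥0∞} (lam : Measure Ω) (x₀ : Ω) (a : ℝ) (ha : 0 < a)
    (hJ : ∫⁻ r in Ioi a, lam (ball G x₀ r) / ENNReal.ofReal (r ^ 2) < ∞) (R : ℝ) :
    lam (ball G x₀ R) ≠ ∞ := by
  intro hR
  set b := max a R with hb
  have hb0 : 0 < b := lt_max_of_lt_left ha
  have : ∫⁻ r in Ioi b, lam (ball G x₀ R) / ENNReal.ofReal (r ^ 2) < ∞ := by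
    refine lt_of_le_of_lt ?_ hJ
    calc _ ≤ ∫⁻ r in Ioi b, lam (ball G x₀ r) / ENNReal.ofReal (r ^ 2) := by
          apply setLIntegral_mono' measurableSet_Ioi
          intro r hr
          apply ENNReal.div_le_div_right
          exact measure_mono (ball_mono G x₀ ((le_max_right a R).trans (le_of_lt hr)))
      _ ≤ _ := lintegral_mono_set (Ioi_subset_Ioi (le_max_left _ _))
  simp_rw [hR, div_eq_mul_inv] at this
  rw [lintegral_const_mul _ (by fun_prop), aux_inv b hb0, ENNReal.top_mul (by simp)] at this
  exact lt_irrefl _ this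

lemma necessity [SecondCountableTopology Ω] [OpensMeasurableSpace Ω]
    {G : Ω → Ω → ℝ≥0∞} {κ : ℝ} (h : QK G κ) {q : ℝ} (hq0 : 0 < q) (hq1 : q < 1)
    (μ σ : Measure Ω) [SFinite μ] [SFinite σ] (hσ : σ ≠ 0) (u : Ω → ℝ≥0∞)
    (hs : IsSupSol G σ q (pot G μ) u) (x₀ : Ω) (a : ℝ) (ha : 0 < a) : growthConds G q σ μ x₀ a := by
  obtain ⟨hu, hpos, hsup⟩ := hs
  have hsup' : ∀ᵐ x ∂σ, potF G σ (fun y => u y ^ q) x ≤ u x ∧ u x < ∞ := by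
    filter_upwards [hsup] with x hx
    exact ⟨le_self_add.trans hx.1, hx.2⟩
  obtain ⟨C, -, hC, hlb⟩ := lower_bound (Ω := Ω) κ q hq0 hq1
  obtain ⟨D, hD, hku⟩ := kappa_upper (Ω := Ω) κ q hq0 hq1
  have hne : (ae σ).NeBot := ae_neBot.2 hσ
  obtain ⟨x₁, hx₁⟩ := hsup.exists
  have h1 : potF G σ (fun y => u y ^ q) x₁ < ∞ := (le_self_add.trans hx₁.1).trans_lt hx₁.2
  have h2 : pot G μ x₁ < ∞ := (le_add_self.trans hx₁.1).trans_lt hx₁.2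
  have h3 : pot G σ x₁ < ∞ := (hlb G h σ u hu hpos hsup' x₁).trans_lt
    (ENNReal.mul_lt_top hC.lt_top (ENNReal.rpow_lt_top_of_nonneg (by linarith) h1.ne))
  set ω := σ.withDensity (fun y => u y ^ q) with hω
  have hum : Measurable (fun y => u y ^ q) := hu.pow_const q
  have h4 : pot G ω x₁ < ∞ := by
    unfold pot
    rw [hω, lintegral_withDensity_eq_lintegral_mul _ hum (h.m x₁)]
    refine lt_of_le_of_lt (le_of_eq ?_) h1
    apply lintegral_congr
    intro y
    simp only [Pi.mul_apply]
    ring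
  have hJ := J_fin h ω x₁ h4 x₀ a ha
  refine ⟨J_fin h σ x₁ h3 x₀ a ha, ?_, J_fin h μ x₁ h2 x₀ a ha⟩
  calc _ ≤ ∫⁻ r in Ioi a, D * (ω (ball G x₀ r) / ENNReal.ofReal (r ^ 2)) := by
        apply lintegral_mono
        intro r
        simp only
        rw [← mul_div_assoc]
        apply ENNReal.div_le_div_right
        exact hku G h σ u hu hpos hsup' _ (ball_meas h.m _ _) (ball_fin ω x₀ a ha hJ r)
    _ = D * _ := lintegral_const_mul' _ _ hD
    _ < ∞ := ENNReal.mul_lt_top hD.lt_top hJ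

lemma pot_pos {G : Ω → Ω → ℝ≥0∞} {κ : ℝ} (h : QK G κ) (σ : Measure Ω) (hσ : σ ≠ 0)
    (f : Ω → ℝ≥0∞) (hf : Measurable f) (hpos : ∀ᵐ x ∂σ, 0 < f x) (x : Ω) : 0 < potF G σ f x := by
  rw [pos_iff_ne_zero]
  intro h0
  unfold potF at h0
  have hmm : Measurable (fun y => G x y * f y) := (h.m x).mul hf
  rw [lintegral_eq_zero_iff hmm] at h0
  have hne : (ae σ).NeBot := ae_neBot.2 hσ
  obtain ⟨y, hy1, hy2⟩ := (h0.and hpos).exists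
  simp only [Pi.zero_apply, mul_eq_zero] at hy1
  rcases hy1 with h1 | h1
  · exact (h.pos x y).ne' h1
  · exact hy2.ne' h1

lemma potF_meas {G : Ω → Ω → ℝ≥0∞} {κ : ℝ} (h : QK G κ) (σ : Measure Ω) [SFinite σ]
    (f : Ω → ℝ≥0∞) (hf : Measurable f) : Measurable (potF G σ f) := by
  have : Measurable (fun p : Ω × Ω => G p.1 p.2 * f p.2) := h.mj.mul (hf.comp measurable_snd)
  exact this.lintegral_prod_right'

lemma sup_to_sol {G : Ω → Ω → ℝ≥0∞} {κ : ℝ} (h : QK G κ) {q : ℝ} (hq0 : 0 < q) (hq1 : q < 1)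
    (μ σ : Measure Ω) [SFinite μ] [SFinite σ] (hσ : σ ≠ 0) (u : Ω → ℝ≥0∞)
    (hs : IsSupSol G σ q (pot G μ) u) : ∃ v, IsSol G σ q (pot G μ) v := by
  obtain ⟨hu, hpos, hsup⟩ := hs
  obtain ⟨C, hC0, hC, hlb⟩ := lower_bound (Ω := Ω) κ q hq0 hq1
  have h1q : 0 < 1 - q := by linarith
  set Φ : (Ω → ℝ≥0∞) → (Ω → ℝ≥0∞) := fun w x => potF G σ (fun y => w y ^ q) x + pot G μ x with hΦ
  have hΦmono : ∀ w w' : Ω → ℝ≥0∞, (∀ᵐ x ∂σ, w x ≤ w' x) → ∀ x, Φ w x ≤ Φ w' x := by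
    intro w w' hw x
    simp only [hΦ]
    gcongr
    unfold potF
    apply lintegral_mono_ae
    filter_upwards [hw] with y hy
    gcongr
  have hΦmeas : ∀ w, Measurable w → Measurable (Φ w) := fun w hw =>
    (potF_meas h σ _ (hw.pow_const q)).add (pot_meas h μ)
  set v : ℕ → Ω → ℝ≥0∞ := fun n => Φ^[n] u with hv
  have hvs : ∀ n, v (n+1) = Φ (v n) := fun n => Function.iterate_succ_apply' Φ n u
  have hv0 : v 0 = u := rfl
  have hvm : ∀ n, Measurable (v n) := by
    intro n
    induction n with
    | zero => exact hu
    | succ n ih => rw [hvs]; exact hΦmeas _ ih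
  have hpq : ∀ t : ℝ≥0∞, 0 < t → 0 < t ^ q := fun t ht => ENNReal.rpow_pos_of_nonneg ht hq0.le
  have hvp : ∀ n, ∀ᵐ x ∂σ, 0 < v n x := by
    intro n
    induction n with
    | zero => exact hpos
    | succ n ih =>
      rw [hvs]
      filter_upwards with x
      refine lt_of_lt_of_le (pot_pos h σ hσ (fun y => v n y ^ q) ((hvm n).pow_const q) ?_ x) le_self_add
      filter_upwards [ih] with y hy using hpq _ hy
  have hdec : ∀ n, ∀ᵐ x ∂σ, v (n+1) x ≤ v n x := by
    intro n
    induction n with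
    | zero => filter_upwards [hsup] with x hx using hx.1
    | succ n ih =>
      filter_upwards with x
      have := hΦmono _ _ ih x
      rw [← hvs (n+1), ← hvs n] at this
      exact this
  have hdec' : ∀ n x, v (n+2) x ≤ v (n+1) x := by
    intro n x
    rw [hvs (n+1), hvs n]
    have := hΦmono _ _ (hdec n) x
    rwa [hvs n] at this
  have hfin : ∀ n, ∀ᵐ x ∂σ, v n x < ∞ := by
    intro n
    induction n with
    | zero => filter_upwards [hsup] with x hx using hx.2
    | succ n ih => filter_upwards [ih, hdec n] with x h1 h2 using h2.trans_lt h1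
  have hlow : ∀ n x, (pot G σ x / C) ^ (1 / (1 - q)) ≤ v (n+1) x := by
    intro n x
    have := hlb G h σ (v n) (hvm n) (hvp n) (by
      filter_upwards [hdec n, hfin n] with y h1 h2
      rw [hvs] at h1
      exact ⟨le_self_add.trans h1, h2⟩) x
    have h2 : pot G σ x / C ≤ (v (n+1) x) ^ (1 - q) := by
      apply ENNReal.div_le_of_le_mul'
      refine this.trans ?_
      rw [hvs]
      gcongr
      exact le_self_add
    calc _ ≤ ((v (n+1) x) ^ (1 - q)) ^ (1 / (1 - q)) := by gcongr
      _ = _ := by rw [← ENNReal.rpow_mul, mul_one_div_cancel h1q.ne', ENNReal.rpow_one]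
  have hσp : ∀ x, 0 < pot G σ x := by
    intro x
    have := pot_pos h σ hσ (fun _ => 1) measurable_const (by simp) x
    simpa [potF, pot] using this
  have hlp : ∀ x, 0 < (pot G σ x / C) ^ (1 / (1 - q)) := fun x =>
    ENNReal.rpow_pos_of_nonneg (ENNReal.div_pos (hσp x).ne' hC) (by positivity)
  set w : Ω → ℝ≥0∞ := fun x => ⨅ n, v (n+1) x with hw
  have hwp : ∀ x, 0 < w x := fun x => (hlp x).trans_le (le_iInf fun n => hlow n x)
  have hanti : ∀ x, Antitone (fun n => v (n+1) x) := fun x => antitone_nat_of_succ_le (fun n => hdec' n x)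
  refine ⟨w, Measurable.iInf (fun n => hvm _), Filter.Eventually.of_forall hwp, ?_⟩
  filter_upwards [hsup, hfin 1] with x hx hx1
  refine ⟨?_, (iInf_le _ 0).trans_lt hx1⟩
  have e1 : w x = ⨅ n, v (n+2) x := by
    apply le_antisymm
    · exact le_iInf fun n => iInf_le _ (n+1)
    · exact le_iInf fun n => (iInf_le _ n).trans (hdec' n x)
  have e2 : potF G σ (fun y => w y ^ q) x = ⨅ n, potF G σ (fun y => v (n+1) y ^ q) x := by
    unfold potF
    rw [← lintegral_iInf]
    · apply lintegral_congr
      intro y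
      have : w y ^ q = ⨅ n, v (n+1) y ^ q := (ENNReal.orderIsoRpow q hq0).map_iInf _
      show G x y * w y ^ q = ⨅ n, G x y * v (n+1) y ^ q
      rw [this, ENNReal.mul_iInf']
      · intro _ h0
        rw [← this] at h0
        exact absurd h0 (hpq _ (hwp y)).ne'
      · intro _; infer_instance
    · intro n; exact (h.m x).mul ((hvm _).pow_const q)
    · intro n k hnk y
      have := hanti y hnk
      simp only at this ⊢
      gcongr
    · have h3 : v 2 x ≤ u x := by
        have := hΦmono (v 1) u (hdec 0) x
        rw [← hvs 1] at this
        exact this.trans hx.1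
      have h4 : v 2 x ≠ ∞ := (h3.trans_lt hx.2).ne
      rw [hvs 1] at h4
      exact (ENNReal.add_ne_top.1 h4).1
  rw [e2, ENNReal.iInf_add, e1]
  exact iInf_congr fun n => by rw [hvs (n+1)]

/-- main integral estimate -/
lemma key_est {G : Ω → Ω → ℝ≥0∞} {κ : ℝ} (h : QK G κ) {q : ℝ} (hq0 : 0 < q) (hq1 : q < 1)
    (σ lam : Measure Ω) [SFinite σ] [SFinite lam] (x₀ : Ω) (a : ℝ) (ha : 0 < a)
    (J : ℝ≥0∞) (hJ : J = ∫⁻ z, (max (ENNReal.ofReal a) ((G x₀ z)⁻¹))⁻¹ ∂lam) (hJt : J < ∞) :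
    ∫⁻ y, (max (ENNReal.ofReal a) ((G x₀ y)⁻¹))⁻¹ * pot G lam y ^ q ∂σ ≤
      ((∫⁻ r in Set.Ioi a,
      kappa G q (σ.restrict (ball G x₀ r)) ^ (q / (1 - q)) / ENNReal.ofReal (r ^ 2)) ^ (1 - q) +
      ∫⁻ r in Set.Ioi a, σ (ball G x₀ r) / ENNReal.ofReal (r ^ 2)) *
      (ENNReal.ofReal (2 * κ) * J) ^ q := by
  have hκ : 0 < κ := lt_of_lt_of_le (by norm_num) h.hk
  have h1q : 0 < 1 - q := by linarith
  set c := ENNReal.ofReal (2 * κ) with hc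
  have hc0 : c ≠ 0 := by simp [hc, hκ]
  have hct : c ≠ ∞ := ENNReal.ofReal_ne_top
  have hc1 : 1 ≤ c := by
    rw [hc, ← ENNReal.ofReal_one]; exact ENNReal.ofReal_le_ofReal (by linarith [h.hk])
  have hcK : c = 2 * ENNReal.ofReal κ := by
    rw [hc, ENNReal.ofReal_mul (by norm_num)]; simp
  have hfin : ∀ R, lam (ball G x₀ R) ≠ ∞ := ball_fin lam x₀ a ha (by
    rw [layer1 h.m h.pos lam x₀ a ha, ← hJ]; exact hJt)
  have hpm := pot_meas h lam
  -- local estimate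
  have hloc : ∀ r, a < r → ∫⁻ y in ball G x₀ r, pot G lam y ^ q ∂σ ≤
      kappa G q (σ.restrict (ball G x₀ r)) ^ q * lam (ball G x₀ (2 * κ * r)) ^ q +
      σ (ball G x₀ r) * (c * J) ^ q := by
    intro r hr
    have hr0 : 0 < r := ha.trans hr
    set B := ball G x₀ (2 * κ * r) with hB
    have hBm : MeasurableSet B := ball_meas h.m _ _
    have : IsFiniteMeasure (lam.restrict B) := ⟨by
      rw [Measure.restrict_apply_univ]; exact (hfin _).lt_top⟩
    have hfar : ∀ y ∈ ball G x₀ r, ∫⁻ z in Bᶜ, G y z ∂lam ≤ c * J := by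
      intro y hy
      have hy' : (G x₀ y)⁻¹ < ENNReal.ofReal r := hy
      rw [hJ, ← lintegral_const_mul' _ _ hct]
      refine le_trans ?_ (setLIntegral_le_lintegral Bᶜ _)
      apply setLIntegral_mono' hBm.compl
      intro z hz
      have hz' : ENNReal.ofReal (2 * κ * r) ≤ (G x₀ z)⁻¹ := not_lt.1 hz
      apply inv_aux hc0 hct
      rw [inv_inv]
      have h2 : ENNReal.ofReal a ≤ (G x₀ z)⁻¹ := by
        refine le_trans (ENNReal.ofReal_le_ofReal ?_) hz'
        nlinarith [h.hk]
      rw [max_eq_right h2]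
      have hd : (G x₀ z)⁻¹ ≠ ∞ := ENNReal.inv_ne_top.2 (h.pos _ _).ne'
      have h3 : (G x₀ z)⁻¹ + (G x₀ z)⁻¹ ≤ (G x₀ z)⁻¹ + c * (G y z)⁻¹ := by
        calc (G x₀ z)⁻¹ + (G x₀ z)⁻¹ = 2 * (G x₀ z)⁻¹ := by ring
          _ ≤ 2 * (ENNReal.ofReal κ * ((G x₀ y)⁻¹ + (G y z)⁻¹)) := by
            gcongr; exact h.tri _ _ _
          _ = c * (G x₀ y)⁻¹ + c * (G y z)⁻¹ := by rw [hcK]; ring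
          _ ≤ c * ENNReal.ofReal r + c * (G y z)⁻¹ := by gcongr
          _ ≤ _ := by
            gcongr
            rwa [hc, ← ENNReal.ofReal_mul (by positivity)]
      exact (ENNReal.add_le_add_iff_left hd).1 h3
    calc _ ≤ ∫⁻ y in ball G x₀ r, (pot G (lam.restrict B) y ^ q + (c * J) ^ q) ∂σ := by
          apply setLIntegral_mono' (ball_meas h.m _ _)
          intro y hy
          refine le_trans ?_ (ENNReal.rpow_add_le_add_rpow _ _ hq0.le hq1.le)
          gcongr
          have : pot G lam y = pot G (lam.restrict B) y + ∫⁻ z in Bᶜ, G y z ∂lam :=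
            (lintegral_add_compl _ hBm).symm
          rw [this]
          gcongr
          exact hfar y hy
      _ = ∫⁻ y in ball G x₀ r, pot G (lam.restrict B) y ^ q ∂σ + (c * J) ^ q * σ (ball G x₀ r) := by
          rw [lintegral_add_right _ measurable_const, setLIntegral_const]
      _ ≤ _ := by
          rw [mul_comm (σ _)]
          gcongr
          have := kappa_spec G q hq0 (σ.restrict (ball G x₀ r)) (lam.restrict B)
          rwa [Measure.restrict_apply_univ, ENNReal.mul_rpow_of_nonneg _ _ hq0.le] at this
  set ω := σ.withDensity (fun y => pot G lam y ^ q) with hω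
  have hpqm : Measurable (fun y => pot G lam y ^ q) := hpm.pow_const q
  have hL : ∫⁻ y, (max (ENNReal.ofReal a) ((G x₀ y)⁻¹))⁻¹ * pot G lam y ^ q ∂σ =
      ∫⁻ r in Ioi a, ω (ball G x₀ r) / ENNReal.ofReal (r ^ 2) := by
    have hwm : Measurable (fun y => (max (ENNReal.ofReal a) ((G x₀ y)⁻¹))⁻¹) :=
      (measurable_const.max (h.m x₀).inv).inv
    rw [layer1 h.m h.pos ω x₀ a ha, hω, lintegral_withDensity_eq_lintegral_mul _ hpqm hwm]
    apply lintegral_congr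
    intro y
    simp only [Pi.mul_apply]
    exact mul_comm _ _
  set Kf : ℝ → ℝ≥0∞ := fun r => kappa G q (σ.restrict (ball G x₀ r)) ^ (q / (1 - q)) with hKf
  have hKm : Measurable Kf := by
    apply Monotone.measurable
    intro r s hrs
    simp only [hKf]
    gcongr
    exact kappa_mono G q hq0 (Measure.restrict_mono (ball_mono G x₀ hrs) le_rfl)
  have hlm : Measurable (fun r => lam (ball G x₀ (2 * κ * r))) := by
    apply Monotone.measurable
    intro r s hrs
    exact measure_mono (ball_mono G x₀ (by gcongr))
  have hsm : Measurable (fun r => σ (ball G x₀ r)) := by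
    apply Monotone.measurable
    intro r s hrs
    exact measure_mono (ball_mono G x₀ hrs)
  have hH : ∫⁻ r in Ioi a, (Kf r / ENNReal.ofReal (r ^ 2)) ^ (1 - q) *
      (lam (ball G x₀ (2 * κ * r)) / ENNReal.ofReal (r ^ 2)) ^ q ≤
      (∫⁻ r in Ioi a, Kf r / ENNReal.ofReal (r ^ 2)) ^ (1 - q) * (c * J) ^ q := by
    refine (ENNReal.lintegral_mul_norm_pow_le (hKm.div (by fun_prop)).aemeasurable
      (hlm.div (by fun_prop)).aemeasurable h1q.le hq0.le (by ring)).trans ?_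
    refine mul_le_mul_right (ENNReal.rpow_le_rpow ?_ hq0.le) _
    change ∫⁻ r in Ioi a, lam (ball G x₀ (2 * κ * r)) / ENNReal.ofReal (r ^ 2) ≤ c * J
    rw [layer h.m h.pos lam x₀ a (2 * κ) ha (by positivity), hJ, ← lintegral_const_mul' _ _ hct]
    apply lintegral_mono
    intro z
    apply inv_aux hc0 hct
    rw [inv_inv, inv_inv]
    apply max_le
    · calc ENNReal.ofReal a = 1 * ENNReal.ofReal a := (one_mul _).symm
        _ ≤ _ := by gcongr; exact le_max_left _ _
    · calc (G x₀ z)⁻¹ = c * ((G x₀ z)⁻¹ / c) := (ENNReal.mul_div_cancel hc0 hct).symm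
        _ ≤ _ := by gcongr; exact le_max_right _ _
  rw [hL]
  calc _ ≤ ∫⁻ r in Ioi a, ((Kf r / ENNReal.ofReal (r ^ 2)) ^ (1 - q) *
      (lam (ball G x₀ (2 * κ * r)) / ENNReal.ofReal (r ^ 2)) ^ q +
      (σ (ball G x₀ r) / ENNReal.ofReal (r ^ 2)) * (c * J) ^ q) := by
        apply setLIntegral_mono' measurableSet_Ioi
        intro r hr
        have hr0 : 0 < r := ha.trans hr
        rw [hω, withDensity_apply _ (ball_meas h.m _ _)]
        set W := ENNReal.ofReal (r ^ 2) with hW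
        have hW0 : W ≠ 0 := by simp [hW]; positivity
        have hWt : W ≠ ∞ := ENNReal.ofReal_ne_top
        refine (ENNReal.div_le_div_right (hloc r hr) W).trans (le_of_eq ?_)
        have hWW : (W ^ (1 - q))⁻¹ * (W ^ q)⁻¹ = W⁻¹ := by
          rw [← ENNReal.mul_inv (Or.inr (ENNReal.rpow_ne_top_of_nonneg hq0.le hWt))
            (Or.inl (ENNReal.rpow_ne_top_of_nonneg h1q.le hWt)), ← ENNReal.rpow_add _ _ hW0 hWt]
          simp
        have hKK : Kf r ^ (1 - q) = kappa G q (σ.restrict (ball G x₀ r)) ^ q := by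
          simp only [hKf]
          rw [← ENNReal.rpow_mul]
          congr 1
          field_simp
        rw [ENNReal.div_rpow_of_nonneg _ _ h1q.le, ENNReal.div_rpow_of_nonneg _ _ hq0.le, hKK]
        simp only [div_eq_mul_inv]
        rw [add_mul, ← hWW]
        ring
    _ = (∫⁻ r in Ioi a, (Kf r / ENNReal.ofReal (r ^ 2)) ^ (1 - q) *
      (lam (ball G x₀ (2 * κ * r)) / ENNReal.ofReal (r ^ 2)) ^ q) +
      (∫⁻ r in Ioi a, (σ (ball G x₀ r) / ENNReal.ofReal (r ^ 2))) * (c * J) ^ q := by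
        have hsd : Measurable (fun r => σ (ball G x₀ r) / ENNReal.ofReal (r ^ 2)) :=
          hsm.div (by fun_prop)
        rw [lintegral_add_right _ (hsd.mul_const _), lintegral_mul_const _ hsd]
    _ ≤ _ := by
        rw [add_mul]
        exact add_le_add hH le_rfl

lemma exists_bound (q : ℝ) (hq0 : 0 < q) (hq1 : q < 1) (A M : ℝ≥0∞) (hA : A ≠ ∞) (hM : M ≠ ∞) :
    ∃ X : ℝ≥0∞, X ≠ ∞ ∧ A * (X + M) ^ q ≤ X := by
  have h1q : 0 < 1 - q := by linarith
  set Y := 2 ^ q * A with hY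
  have hYt : Y ≠ ∞ := ENNReal.mul_ne_top (by simp) hA
  have hYq : Y ^ (1 / (1 - q)) ≠ ∞ := ENNReal.rpow_ne_top_of_nonneg (by positivity) hYt
  set X := M + Y ^ (1 / (1 - q)) + 1 with hX
  have hXt : X ≠ ∞ := 
    ENNReal.add_ne_top.2 ⟨ENNReal.add_ne_top.2 ⟨hM, hYq⟩, ENNReal.one_ne_top⟩
  have hX0 : X ≠ 0 := by simp [hX]
  refine ⟨X, hXt, ?_⟩
  have h1 : Y ≤ X ^ (1 - q) := by
    calc Y = (Y ^ (1 / (1 - q))) ^ (1 - q) := by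
          rw [← ENNReal.rpow_mul, one_div_mul_cancel h1q.ne', ENNReal.rpow_one]
      _ ≤ _ := by
        gcongr
        exact le_trans le_add_self le_self_add
  calc A * (X + M) ^ q ≤ A * (2 * X) ^ q := by
        gcongr
        rw [two_mul]
        gcongr
        rw [hX, add_assoc]; exact le_self_add
    _ = Y * X ^ q := by rw [ENNReal.mul_rpow_of_nonneg _ _ hq0.le, hY]; ring
    _ ≤ X ^ (1 - q) * X ^ q := by gcongr
    _ = X := by rw [← ENNReal.rpow_add _ _ hX0 hXt]; simp

lemma sufficiency {G : Ω → Ω → ℝ≥0∞} {κ : ℝ} (h : QK G κ) {q : ℝ} (hq0 : 0 < q) (hq1 : q < 1)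
    (μ σ : Measure Ω) [SFinite μ] [SFinite σ] (hσ : σ ≠ 0) (x₀ : Ω) (a : ℝ) (ha : 0 < a)
    (hg : growthConds G q σ μ x₀ a) : ∃ u, IsSupSol G σ q (pot G μ) u := by
  obtain ⟨g1, g2, g3⟩ := hg
  have h1q : 0 < 1 - q := by linarith
  set wt : Ω → ℝ≥0∞ := fun z => (max (ENNReal.ofReal a) ((G x₀ z)⁻¹))⁻¹ with hwt
  have hwtm : Measurable wt := (measurable_const.max (h.m x₀).inv).inv
  set M := ∫⁻ z, wt z ∂(μ + σ) with hM
  have hMt : M ≠ ∞ := by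
    rw [hM, lintegral_add_measure]
    rw [layer1 h.m h.pos _ x₀ a ha] at g1 g3
    exact ENNReal.add_ne_top.2 ⟨g3.ne, g1.ne⟩
  set A0 := (∫⁻ r in Set.Ioi a,
      kappa G q (σ.restrict (ball G x₀ r)) ^ (q / (1 - q)) / ENNReal.ofReal (r ^ 2)) ^ (1 - q) +
      ∫⁻ r in Set.Ioi a, σ (ball G x₀ r) / ENNReal.ofReal (r ^ 2) with hA0
  have hA0t : A0 ≠ ∞ := ENNReal.add_ne_top.2 ⟨ENNReal.rpow_ne_top_of_nonneg h1q.le g2.ne, g1.ne⟩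
  obtain ⟨X, hXt, hX⟩ := exists_bound q hq0 hq1 (A0 * ENNReal.ofReal (2 * κ) ^ q) M
    (ENNReal.mul_ne_top hA0t (ENNReal.rpow_ne_top_of_nonneg hq0.le ENNReal.ofReal_ne_top)) hMt
  set lam : (Ω → ℝ≥0∞) → Measure Ω := fun u => σ.withDensity (fun y => u y ^ q) + (μ + σ) with hlam
  set Φ : (Ω → ℝ≥0∞) → (Ω → ℝ≥0∞) := fun u => pot G (lam u) with hΦ
  have hΦe : ∀ u, Measurable u → ∀ x, Φ u x = potF G σ (fun y => u y ^ q) x + pot G (μ + σ) x := by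
    intro u hu x
    have hum : Measurable (fun y => u y ^ q) := hu.pow_const q
    simp only [hΦ, hlam, pot, potF]
    rw [lintegral_add_measure _ (σ.withDensity _),
      lintegral_withDensity_eq_lintegral_mul _ hum (h.m x)]
    congr 1
    apply lintegral_congr
    intro y
    simp only [Pi.mul_apply]
    exact mul_comm _ _
  set v : ℕ → Ω → ℝ≥0∞ := fun n => Φ^[n] (fun _ => 0) with hv
  have hvs : ∀ n, v (n+1) = Φ (v n) := fun n => Function.iterate_succ_apply' Φ n _
  have hvm : ∀ n, Measurable (v n) := by
    intro n
    induction n with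
    | zero => exact measurable_const
    | succ n ih => rw [hvs]; exact pot_meas h _
  have hinc : ∀ n x, v n x ≤ v (n+1) x := by
    intro n
    induction n with
    | zero => intro x; exact zero_le
    | succ n ih =>
      intro x
      rw [hvs (n+1), hΦe _ (hvm _), hvs n, hΦe _ (hvm _)]
      gcongr
      unfold potF
      apply lintegral_mono
      intro y
      have := ih y
      rw [hvs n] at this
      simp only
      gcongr
  have hmono : ∀ x, Monotone (fun n => v n x) := fun x => monotone_nat_of_le_succ (fun n => hinc n x)
  have hI : ∀ n, ∫⁻ y, wt y * v n y ^ q ∂σ ≤ X := by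
    intro n
    induction n with
    | zero =>
      have : ∀ y, v 0 y = 0 := fun y => rfl
      simp [this, hq0]
    | succ n ih =>
      have hum : Measurable (fun y => v n y ^ q) := (hvm n).pow_const q
      have hJ : ∫⁻ z, wt z ∂(lam (v n)) = ∫⁻ y, wt y * v n y ^ q ∂σ + M := by
        simp only [hlam]
        rw [lintegral_add_measure _ (σ.withDensity _),
          lintegral_withDensity_eq_lintegral_mul _ hum hwtm]
        congr 1
        apply lintegral_congr
        intro y
        simp only [Pi.mul_apply]
        exact mul_comm _ _
      have hJle : ∫⁻ z, wt z ∂(lam (v n)) ≤ X + M := by rw [hJ]; gcongr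
      rw [hvs]
      refine (key_est h hq0 hq1 σ (lam (v n)) x₀ a ha _ rfl
        (hJle.trans_lt (ENNReal.add_lt_top.2 ⟨hXt.lt_top, hMt.lt_top⟩))).trans ?_
      rw [← hA0]
      calc _ ≤ A0 * (ENNReal.ofReal (2 * κ) * (X + M)) ^ q := by gcongr
        _ = A0 * ENNReal.ofReal (2 * κ) ^ q * (X + M) ^ q := by
          rw [ENNReal.mul_rpow_of_nonneg _ _ hq0.le]; ring
        _ ≤ X := hX
  set u : Ω → ℝ≥0∞ := fun x => ⨆ n, v n x with hu
  have hum : Measurable u := Measurable.iSup hvm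
  have huq : ∀ y, u y ^ q = ⨆ n, v n y ^ q := fun y => (ENNReal.orderIsoRpow q hq0).map_iSup _
  have hconv : ∀ (f : Ω → ℝ≥0∞), Measurable f →
      ∫⁻ y, f y * u y ^ q ∂σ = ⨆ n, ∫⁻ y, f y * v n y ^ q ∂σ := by
    intro f hf
    simp_rw [huq, ENNReal.mul_iSup]
    rw [lintegral_iSup]
    · intro n; exact hf.mul ((hvm n).pow_const q)
    · intro n k hnk y
      have := hmono y hnk
      simp only at this ⊢
      gcongr
  have hule : ∀ x, potF G σ (fun y => u y ^ q) x + pot G (μ + σ) x ≤ u x := by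
    intro x
    unfold potF
    rw [hconv _ (h.m x), ENNReal.iSup_add]
    apply iSup_le
    intro n
    have := hΦe (v n) (hvm n) x
    rw [← hvs] at this
    unfold potF at this
    rw [← this]
    exact le_iSup (fun n => v n x) (n+1)
  have hσp : ∀ x, 0 < pot G σ x := by
    intro x
    have := pot_pos h σ hσ (fun _ => 1) measurable_const (by simp) x
    simpa [potF, pot] using this
  have hadd : ∀ x, pot G (μ + σ) x = pot G μ x + pot G σ x := fun x => lintegral_add_measure _ _ _
  refine ⟨u, hum, ?_, ?_⟩
  · filter_upwards with x
    refine (hσp x).trans_le (le_trans ?_ (hule x))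
    rw [hadd, ← add_assoc]
    exact le_add_self
  · have hfin : ∫⁻ y, wt y * u y ^ q ∂σ ≠ ∞ := by
      rw [hconv _ hwtm]
      exact ((iSup_le hI).trans_lt hXt.lt_top).ne
    filter_upwards [ae_lt_top (hwtm.mul (hum.pow_const q)) hfin] with x hx
    refine ⟨le_trans ?_ (hule x), ?_⟩
    · rw [hadd]
      gcongr
      exact le_self_add
    · by_contra hcon
      have hux : u x = ∞ := not_lt_top_iff.1 hcon
      have hw0 : wt x ≠ 0 := by
        simp only [hwt]
        apply ENNReal.inv_ne_zero.2
        exact (max_lt ENNReal.ofReal_lt_top (ENNReal.inv_lt_top.2 (h.pos _ _))).ne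
      have hx2 : wt x * u x ^ q < ∞ := hx
      rw [hux, ENNReal.top_rpow_of_pos hq0, ENNReal.mul_top hw0] at hx2
      exact lt_irrefl _ hx2

/-- a nontrivial solution (equivalently, super-solution) of
`u = G(u^q dσ) + Gμ` exists iff the three growth conditions hold for some
(equivalently, all) `x₀ ∈ Ω` and `a > 0`. -/
theorem statement5 [LocallyCompactSpace Ω] [T2Space Ω] [SecondCountableTopology Ω]
    [BorelSpace Ω] (G : Ω → Ω → ℝ≥0∞) (κ q : ℝ) (hq0 : 0 < q) (hq1 : q < 1)
    (μ σ : Measure Ω) [IsLocallyFiniteMeasure μ] [IsLocallyFiniteMeasure σ] (hσ : σ ≠ 0)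
    (hG : IsQuasiMetricKernel G κ) :
    ((∃ u : Ω → ℝ≥0∞, IsSol G σ q (pot G μ) u) ↔
       ∃ x₀ : Ω, ∃ a : ℝ, 0 < a ∧ growthConds G q σ μ x₀ a) ∧
    ((∃ u : Ω → ℝ≥0∞, IsSupSol G σ q (pot G μ) u) ↔
       ∃ x₀ : Ω, ∃ a : ℝ, 0 < a ∧ growthConds G q σ μ x₀ a) ∧
    ((∃ x₀ : Ω, ∃ a : ℝ, 0 < a ∧ growthConds G q σ μ x₀ a) ↔
       ∀ x₀ : Ω, ∀ a : ℝ, 0 < a → growthConds G q σ μ x₀ a) := by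
  have h := QK.of hG
  have hne : Nonempty Ω := by
    by_contra hcon
    rw [not_nonempty_iff] at hcon
    exact hσ (Measure.eq_zero_of_isEmpty σ)
  have nec : (∃ u : Ω → ℝ≥0∞, IsSupSol G σ q (pot G μ) u) →
      ∀ x₀ : Ω, ∀ a : ℝ, 0 < a → growthConds G q σ μ x₀ a := fun ⟨u, hu⟩ x₀ a ha =>
    necessity h hq0 hq1 μ σ hσ u hu x₀ a ha
  have suf : (∃ x₀ : Ω, ∃ a : ℝ, 0 < a ∧ growthConds G q σ μ x₀ a) →
      ∃ u : Ω → ℝ≥0∞, IsSupSol G σ q (pot G μ) u := fun ⟨x₀, a, ha, hg⟩ =>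
    sufficiency h hq0 hq1 μ σ hσ x₀ a ha hg
  have s2s : (∃ u : Ω → ℝ≥0∞, IsSupSol G σ q (pot G μ) u) → ∃ u : Ω → ℝ≥0∞, IsSol G σ q (pot G μ) u :=
    fun ⟨u, hu⟩ => sup_to_sol h hq0 hq1 μ σ hσ u hu
  have sol2 : (∃ u : Ω → ℝ≥0∞, IsSol G σ q (pot G μ) u) → ∃ u : Ω → ℝ≥0∞, IsSupSol G σ q (pot G μ) u :=
    fun ⟨u, h1, h2, h3⟩ => ⟨u, h1, h2, h3.mono fun x hx => ⟨hx.1.ge, hx.2⟩⟩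
  have a2e : (∀ x₀ : Ω, ∀ a : ℝ, 0 < a → growthConds G q σ μ x₀ a) →
      ∃ x₀ : Ω, ∃ a : ℝ, 0 < a ∧ growthConds G q σ μ x₀ a := fun hall =>
    ⟨Classical.choice hne, 1, one_pos, hall _ 1 one_pos⟩
  exact ⟨⟨fun hu => a2e (nec (sol2 hu)), fun hg => s2s (suf hg)⟩,
    ⟨fun hu => a2e (nec hu), suf⟩, ⟨fun hg => nec (suf hg), a2e⟩⟩

end NPE
end
end
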